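/- Let f : D^I_{p,q} → D^I_{p',q'} be a proper holomorphic map, where p, q, p', q' are positive integers with p ≥ q ≥ 2 and q' < p. Then q ≤ q' and p ≤ p'. -/

import Mathlib

open Matrix
open scoped ComplexOrder

attribute [local instance] Matrix.normedAddCommGroup Matrix.normedSpace

/-- The type-I irreducible bounded symmetric domain `D^I_{m,n}`,
realized as the set of complex `m × n` matrices `Z` with `I - Zᴴ Z` positive definite. -/
def typeIDomain (m n : ℕ) : Set (Matrix (Fin m) (Fin n) ℂ) :=
  {Z | (1 - Zᴴ * Z).PosDef}

/-- `f` maps `D` into `D'` and the `f`-preimage of every compact subset of `D'`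
is a compact subset of `D`. -/
def ProperOn {E F : Type*} [TopologicalSpace E] [TopologicalSpace F]
    (f : E → F) (D : Set E) (D' : Set F) : Prop :=
  Set.MapsTo f D D' ∧ ∀ K : Set F, K ⊆ D' → IsCompact K → IsCompact (D ∩ f ⁻¹' K)

section

/-- squared Euclidean norm -/
noncomputable def nsq {a : ℕ} (x : Fin a → ℂ) : ℝ := ∑ i, ‖x i‖ ^ 2

theorem nsq_nonneg {a : ℕ} (x : Fin a → ℂ) : 0 ≤ nsq x :=
  Finset.sum_nonneg fun _ _ => by positivity

theorem nsq_eq_zero {a : ℕ} {x : Fin a → ℂ} (h : nsq x = 0) : x = 0 := by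
  funext i
  have := (Finset.sum_eq_zero_iff_of_nonneg (fun j _ => by positivity)).1 h i (Finset.mem_univ _)
  simpa using this

theorem nsq_pos {a : ℕ} {x : Fin a → ℂ} (h : x ≠ 0) : 0 < nsq x :=
  lt_of_le_of_ne (nsq_nonneg x) fun h' => h (nsq_eq_zero h'.symm)

theorem nsq_zero {a : ℕ} : nsq (0 : Fin a → ℂ) = 0 := by simp [nsq]

theorem nsq_continuous {a : ℕ} : Continuous (nsq (a := a)) := by
  unfold nsq; fun_prop

theorem nsq_smul {a : ℕ} (c : ℂ) (x : Fin a → ℂ) : nsq (c • x) = ‖c‖ ^ 2 * nsq x := by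
  simp [nsq, Finset.mul_sum, mul_pow]

theorem nsq_dot {a : ℕ} (x : Fin a → ℂ) : star x ⬝ᵥ x = (nsq x : ℂ) := by
  simp only [dotProduct, nsq, Pi.star_apply, RCLike.star_def, Complex.conj_mul']
  push_cast; rfl

theorem nsq_eq_norm {a : ℕ} (x : Fin a → ℂ) : nsq x = ‖WithLp.toLp 2 x‖ ^ 2 := by
  rw [EuclideanSpace.norm_sq_eq]; rfl

theorem dot_le {a : ℕ} (u x : Fin a → ℂ) : ‖star u ⬝ᵥ x‖ ^ 2 ≤ nsq u * nsq x := by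
  have h := norm_inner_le_norm (𝕜 := ℂ) (WithLp.toLp 2 u) (WithLp.toLp 2 x)
  have e : inner ℂ (WithLp.toLp 2 u) (WithLp.toLp 2 x) = star u ⬝ᵥ x := by
    rw [EuclideanSpace.inner_toLp_toLp, dotProduct_comm]
  rw [e] at h
  rw [nsq_eq_norm, nsq_eq_norm, ← mul_pow]
  gcongr

theorem nsq_sub {a : ℕ} (x y : Fin a → ℂ) :
    nsq (x - y) = nsq x - 2 * (star y ⬝ᵥ x).re + nsq y := by
  have e : inner ℂ (WithLp.toLp 2 x) (WithLp.toLp 2 y) = star x ⬝ᵥ y := by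
    rw [EuclideanSpace.inner_toLp_toLp, dotProduct_comm]
  have e' : star y ⬝ᵥ x = star (star x ⬝ᵥ y) := by
    simp [dotProduct, mul_comm]
  rw [nsq_eq_norm, nsq_eq_norm, nsq_eq_norm, WithLp.toLp_sub, norm_sub_sq (𝕜 := ℂ), e, e']
  simp

theorem quad_eq {a b : ℕ} (Z : Matrix (Fin a) (Fin b) ℂ) (x : Fin b → ℂ) :
    star x ⬝ᵥ (1 - Zᴴ * Z) *ᵥ x = ((nsq x - nsq (Z *ᵥ x) : ℝ) : ℂ) := by
  rw [sub_mulVec, one_mulVec, dotProduct_sub, nsq_dot, ← mulVec_mulVec, dotProduct_mulVec,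
    ← star_mulVec, nsq_dot]
  push_cast; rfl

theorem herm {a b : ℕ} (Z : Matrix (Fin a) (Fin b) ℂ) : (1 - Zᴴ * Z).IsHermitian :=
  isHermitian_one.sub (isHermitian_conjTranspose_mul_self Z)

theorem mem_dom {a b : ℕ} {Z : Matrix (Fin a) (Fin b) ℂ} :
    Z ∈ typeIDomain a b ↔ ∀ x, x ≠ 0 → nsq (Z *ᵥ x) < nsq x := by
  unfold typeIDomain
  rw [Set.mem_ofPred_eq, posDef_iff_dotProduct_mulVec]
  constructor
  · rintro ⟨_, h⟩ x hx
    have := h hx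
    rw [quad_eq] at this
    have : 0 < nsq x - nsq (Z *ᵥ x) := by exact_mod_cast this
    linarith
  · intro h
    refine ⟨herm Z, fun x hx => ?_⟩
    rw [quad_eq]
    have := h x hx
    have : 0 < nsq x - nsq (Z *ᵥ x) := by linarith
    exact_mod_cast this

theorem contr_le {a b : ℕ} {Z : Matrix (Fin a) (Fin b) ℂ} (h : Z ∈ typeIDomain a b)
    (x : Fin b → ℂ) : nsq (Z *ᵥ x) ≤ nsq x := by
  by_cases hx : x = 0
  · simp [hx, nsq_zero]
  · exact (mem_dom.1 h x hx).le

/-- A contraction which is isometric at `v`. -/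
theorem contr_adj {a b : ℕ} {Z : Matrix (Fin a) (Fin b) ℂ} (h : ∀ x, nsq (Z *ᵥ x) ≤ nsq x)
    {v : Fin b → ℂ} (hv : nsq (Z *ᵥ v) = nsq v) : Zᴴ *ᵥ (Z *ᵥ v) = v := by
  have hp : (1 - Zᴴ * Z).PosSemidef := by
    rw [posSemidef_iff_dotProduct_mulVec]
    refine ⟨herm Z, fun x => ?_⟩
    rw [quad_eq]
    have := h x
    have : 0 ≤ nsq x - nsq (Z *ᵥ x) := by linarith
    exact_mod_cast this
  have := (hp.dotProduct_mulVec_zero_iff v).1 (by rw [quad_eq, hv]; simp)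
  rw [sub_mulVec, one_mulVec, ← mulVec_mulVec, sub_eq_zero] at this
  exact this.symm

theorem entry_le {a b : ℕ} {Z : Matrix (Fin a) (Fin b) ℂ} (h : ∀ x, nsq (Z *ᵥ x) ≤ nsq x)
    (i : Fin a) (j : Fin b) : ‖Z i j‖ ≤ 1 := by
  have h1 := h (Pi.single j 1)
  have h2 : nsq (Pi.single j 1 : Fin b → ℂ) = 1 := by
    unfold nsq
    rw [Finset.sum_eq_single j]
    · simp
    · intro k _ hk; simp [Pi.single_eq_of_ne hk]
    · simp
  have h3 : ‖Z i j‖ ^ 2 ≤ nsq (Z *ᵥ Pi.single j 1) := by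
    have := Finset.single_le_sum (f := fun i => ‖(Z *ᵥ Pi.single j 1) i‖ ^ 2)
      (fun _ _ => by positivity) (Finset.mem_univ i)
    simpa [nsq] using this
  nlinarith [norm_nonneg (Z i j)]

/-- Schwarz-Pick at a point with value near 1. -/
theorem schwarz_near {R : ℝ} (hR : 1 < R) {h : ℂ → ℂ} (hd : DifferentiableOn ℂ h (Metric.ball 0 R))
    (hb : ∀ s ∈ Metric.ball (0 : ℂ) R, ‖h s‖ < 1) {α : ℝ} (hα0 : 0 ≤ α) (hα : h 0 = α) :
    ‖1 - h 1‖ * (R - 1) ≤ (1 - α) * (R + 1) := by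
  have h0 : (0 : ℂ) ∈ Metric.ball (0 : ℂ) R := by simp; linarith
  have h1 : (1 : ℂ) ∈ Metric.ball (0 : ℂ) R := by simp; linarith
  have hα1 : α < 1 := by
    have := hb 0 h0
    rw [hα, Complex.norm_real, Real.norm_of_nonneg hα0] at this
    exact this
  have hden : ∀ s ∈ Metric.ball (0 : ℂ) R, 1 - α * h s ≠ 0 := by
    intro s hs h'
    have e : (α : ℂ) * h s = 1 := (sub_eq_zero.1 h').symm
    have := congrArg norm e
    rw [norm_mul, Complex.norm_real, Real.norm_of_nonneg hα0, norm_one] at this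
    nlinarith [hb s hs, norm_nonneg (h s)]
  have key := Complex.dist_le_div_mul_dist_of_mapsTo_ball (R₁ := R) (R₂ := 1) (c := 0) (z := 1)
    (f := fun s => (h s - α) / (1 - α * h s)) ?_ ?_ h1
  · simp only [hα, sub_self, zero_div, dist_zero_right, norm_div, norm_one, mul_one] at key
    have hpos : 0 < ‖1 - α * h 1‖ := norm_pos_iff.2 (hden 1 h1)
    rw [div_le_div_iff₀ hpos (by linarith), one_mul] at key
    have e1 : ‖1 - h 1‖ ≤ ‖h 1 - α‖ + (1 - α) := by
      have : 1 - h 1 = -(h 1 - α) + ((1 - α : ℝ) : ℂ) := by push_cast; ring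
      rw [this]
      refine (norm_add_le _ _).trans ?_
      rw [norm_neg, Complex.norm_real, Real.norm_of_nonneg (by linarith)]
    have e2 : ‖1 - α * h 1‖ ≤ ‖1 - h 1‖ + (1 - α) := by
      have : 1 - α * h 1 = (1 - h 1) + ((1 - α : ℝ) : ℂ) * h 1 := by push_cast; ring
      rw [this]
      refine (norm_add_le _ _).trans ?_
      rw [norm_mul, Complex.norm_real, Real.norm_of_nonneg (by linarith)]
      nlinarith [hb 1 h1]
    nlinarith
  · exact (hd.sub_const _).div ((differentiableOn_const _).sub (hd.const_mul _)) hden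
  · intro s hs
    simp only [hα, sub_self, zero_div, Metric.mem_closedBall, dist_zero_right, norm_div]
    rw [div_le_one (norm_pos_iff.2 (hden s hs))]
    rw [← sq_le_sq₀ (norm_nonneg _) (norm_nonneg _), ← Complex.normSq_eq_norm_sq,
      ← Complex.normSq_eq_norm_sq]
    have hh : Complex.normSq (h s) < 1 := by
      rw [Complex.normSq_eq_norm_sq]; nlinarith [hb s hs, norm_nonneg (h s)]
    simp only [Complex.normSq_apply, Complex.sub_re, Complex.sub_im, Complex.ofReal_re,
      Complex.ofReal_im, Complex.one_re, Complex.one_im, Complex.mul_re, Complex.mul_im] at hh ⊢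
    nlinarith [mul_pos (sub_pos.2 hh) (sub_pos.2 (show α ^ 2 < 1 by nlinarith))]

theorem line_approx {a b : ℕ} {g : ℂ → Matrix (Fin a) (Fin b) ℂ} {R : ℝ} (hR : 1 < R)
    (hd : DifferentiableOn ℂ g (Metric.ball 0 R))
    (hm : ∀ s ∈ Metric.ball (0 : ℂ) R, g s ∈ typeIDomain a b)
    {u : Fin a → ℂ} {v : Fin b → ℂ} {α : ℝ} (hα : 0 < α) (hv : nsq v = 1) (hu : nsq u = 1)
    (huv : g 0 *ᵥ v = (α : ℂ) • u) :
    nsq (g 1 *ᵥ v - u) * (R - 1) ≤ 2 * ((1 - α) * (R + 1)) := by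
  have hv0 : v ≠ 0 := by rintro rfl; simp [nsq_zero] at hv
  have key := schwarz_near (h := fun s => star u ⬝ᵥ g s *ᵥ v) hR ?_ ?_ hα.le ?_
  · have h1 : (1 : ℂ) ∈ Metric.ball (0 : ℂ) R := by simp; linarith
    have h2 := mem_dom.1 (hm 1 h1) v hv0
    have h3 := nsq_sub (g 1 *ᵥ v) u
    have h4 : 1 - (star u ⬝ᵥ g 1 *ᵥ v).re ≤ ‖1 - star u ⬝ᵥ g 1 *ᵥ v‖ := by
      refine le_trans ?_ (Complex.re_le_norm _)
      simp
    nlinarith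
  · have : ∀ i j, DifferentiableOn ℂ (fun s => g s i j) (Metric.ball 0 R) := fun i j =>
      differentiableOn_pi.1 (differentiableOn_pi.1 hd i) j
    unfold dotProduct mulVec dotProduct
    fun_prop
  · intro s hs
    have h1 := dot_le u (g s *ᵥ v)
    have h2 := mem_dom.1 (hm s hs) v hv0
    rw [hu, one_mul] at h1
    rw [← abs_of_nonneg (norm_nonneg (star u ⬝ᵥ g s *ᵥ v)), ← sq_lt_one_iff_abs_lt_one]
    linarith
  · simp [huv, nsq_dot, hu]

end

section

open Module Topology

/-- tuples of matrices -/
abbrev Tup (n a b : ℕ) := Fin (n + 1) → Matrix (Fin a) (Fin b) ℂ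

theorem diff_entry {n a b : ℕ} (i : Fin (n + 1)) (x : Fin a) (y : Fin b) :
    Differentiable ℂ (fun F : Tup n a b => F i x y) := by
  have h1 := differentiable_pi.1 (differentiable_id (𝕜 := ℂ) (E := Tup n a b)) i
  have h2 := differentiable_pi.1 (differentiable_id (𝕜 := ℂ) (E := Fin a → Fin b → ℂ)) x
  have h3 := differentiable_pi.1 (differentiable_id (𝕜 := ℂ) (E := Fin b → ℂ)) y
  exact h3.comp (h2.comp h1)

theorem diff_mat_entry {a b : ℕ} (x : Fin a) (y : Fin b) :
    Differentiable ℂ (fun F : Matrix (Fin a) (Fin b) ℂ => F x y) := by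
  have h2 := differentiable_pi.1 (differentiable_id (𝕜 := ℂ) (E := Fin a → Fin b → ℂ)) x
  have h3 := differentiable_pi.1 (differentiable_id (𝕜 := ℂ) (E := Fin b → ℂ)) y
  exact h3.comp h2

theorem diff_mat {E : Type*} [NormedAddCommGroup E] [NormedSpace ℂ E] {a b : ℕ}
    {G : E → Matrix (Fin a) (Fin b) ℂ} (h : ∀ x y, Differentiable ℂ (fun e => G e x y)) :
    Differentiable ℂ G :=
  differentiable_pi.2 fun x => differentiable_pi.2 fun y => h x y

theorem det_diff {b : ℕ} : Differentiable ℂ (fun A : Matrix (Fin b) (Fin b) ℂ => A.det) := by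
  have : ContDiff ℂ 1 (fun A : Matrix (Fin b) (Fin b) ℂ => A.det) := by
    simp only [det_apply]
    refine ContDiff.sum fun σ _ => ContDiff.const_smul _ (contDiff_prod fun i _ => ?_)
    have h2 := contDiff_pi.1 (contDiff_id (n := 1) (𝕜 := ℂ) (E := Fin b → Fin b → ℂ)) (σ i)
    have h3 := contDiff_pi.1 (contDiff_id (n := 1) (𝕜 := ℂ) (E := Fin b → ℂ)) i
    exact h3.comp h2
  exact this.differentiable one_ne_zero

theorem adj_diff {b : ℕ} (i j : Fin b) :
    Differentiable ℂ (fun A : Matrix (Fin b) (Fin b) ℂ => A.adjugate i j) := by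
  simp only [adjugate_apply]
  refine det_diff.comp (diff_mat fun x y => ?_)
  by_cases h : x = j
  · subst h; simp
  · simp only [updateRow_apply, if_neg h]
    exact diff_mat_entry x y

/-- common kernel -/
noncomputable def Tmap {n a b : ℕ} (F : Tup n a b) :
    (Fin b → ℂ) →ₗ[ℂ] (Fin (n + 1) → Fin a → ℂ) :=
  LinearMap.pi fun i => mulVecLin (F i - F 0)

noncomputable def kerT {n a b : ℕ} (F : Tup n a b) : Submodule ℂ (Fin b → ℂ) :=
  LinearMap.ker (Tmap F)

theorem mem_kerT {n a b : ℕ} {F : Tup n a b} {k : Fin b → ℂ} :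
    k ∈ kerT F ↔ ∀ i, F i *ᵥ k = F 0 *ᵥ k := by
  unfold kerT Tmap
  rw [LinearMap.mem_ker]
  constructor
  · intro h i
    have := congrFun h i
    simpa [sub_mulVec, sub_eq_zero] using this
  · intro h
    funext i
    simp [sub_mulVec, h i]

theorem exists_S {n a b : ℕ} (F0 : Tup n a b) :
    ∃ (S : Tup n a b → Matrix (Fin b) (Fin b) ℂ) (p0 : (Fin b → ℂ) → (Fin b → ℂ)),
      Differentiable ℂ S ∧ S F0 = 1 ∧ (∀ k, p0 k ∈ kerT F0) ∧
      ∀ F k, k ∈ kerT F → S F *ᵥ k = p0 k := by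
  obtain ⟨p0, hp0⟩ := LinearMap.exists_leftInverse_of_injective (kerT F0).subtype
    (Submodule.ker_subtype _)
  have hp0' : ∀ e : kerT F0, p0 e = e := fun e => LinearMap.congr_fun hp0 e
  obtain ⟨Λ, hΛ⟩ := LinearMap.exists_leftInverse_of_injective ((Tmap F0).prod p0) (by
    rw [LinearMap.ker_eq_bot']
    intro k hk
    have h1 : Tmap F0 k = 0 := congrArg Prod.fst hk
    have h2 : p0 k = 0 := congrArg Prod.snd hk
    have := hp0' ⟨k, h1⟩
    rw [h2] at this
    exact (congrArg Subtype.val this).symm)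
  have hΛ' : ∀ e : kerT F0, Λ (0, e) = e := fun e => by
    have h1 := LinearMap.congr_fun hΛ (e : Fin b → ℂ)
    have h2 : Tmap F0 (e : Fin b → ℂ) = 0 := e.2
    simpa [h2, hp0'] using h1
  refine ⟨fun F => LinearMap.toMatrix' (Λ ∘ₗ (Tmap F).prod p0), fun k => p0 k, ?_, ?_, ?_, ?_⟩
  · refine diff_mat fun x y => ?_
    simp only [LinearMap.toMatrix'_apply]
    have hc : Differentiable ℂ Λ := Λ.toContinuousLinearMap.differentiable
    have hd : Differentiable ℂ (fun F : Tup n a b =>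
        ((Tmap F (Pi.single y 1), p0 (Pi.single y 1)) : _ × kerT F0)) := by
      refine Differentiable.prodMk ?_ (differentiable_const _)
      refine differentiable_pi.2 fun i => differentiable_pi.2 fun z => ?_
      simp only [Tmap, LinearMap.pi_apply, mulVecLin_apply, mulVec_single_one, col_apply,
        Matrix.sub_apply]
      exact (diff_entry i z y).sub (diff_entry 0 z y)
    exact differentiable_pi.1 (hc.comp hd) x
  · simp only [hΛ]
    exact LinearMap.toMatrix'_id
  · intro k; exact (p0 k).2
  · intro F k hk
    have h2 : Tmap F k = 0 := hk
    rw [LinearMap.toMatrix'_mulVec]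
    simp [h2, hΛ']

theorem semicont {n a b : ℕ} (F0 : Tup n a b) : ∃ M : Tup n a b → ℂ, Differentiable ℂ M ∧
    M F0 ≠ 0 ∧ ∀ F, M F ≠ 0 → finrank ℂ (kerT F) ≤ finrank ℂ (kerT F0) := by
  obtain ⟨S, p0, hS, h1, h2, h3⟩ := exists_S F0
  refine ⟨fun F => (S F).det, det_diff.comp hS, by simp [h1], fun F hF => ?_⟩
  have hinj : Function.Injective (mulVecLin (S F)) := by
    intro x y hxy
    exact mulVec_injective_of_isUnit ((isUnit_iff_isUnit_det _).2 (isUnit_iff_ne_zero.2 hF)) hxy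
  refine LinearMap.finrank_le_finrank_of_injective
    (f := ((mulVecLin (S F)).restrict (p := kerT F) (q := kerT F0) ?_)) ?_
  · intro k hk
    rw [mulVecLin_apply, h3 F k hk]; exact h2 k
  · intro x y hxy
    apply Subtype.ext
    exact hinj (congrArg Subtype.val hxy)

theorem lemmaK {n a b : ℕ} {Ω : Set ℂ} (hΩ : IsOpen Ω) (hc : IsPreconnected Ω) {l0 : ℂ}
    (h0 : l0 ∈ Ω) {F : ℂ → Tup n a b} (hF : DifferentiableOn ℂ F Ω)
    (P : Submodule ℂ ((Fin a → ℂ) × (Fin b → ℂ)))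
    (hyp : ∀ᶠ l in 𝓝 l0, ∃ E : Submodule ℂ (Fin b → ℂ),
      finrank ℂ (kerT (F l0)) ≤ finrank ℂ E ∧
      ∀ k ∈ E, (∀ i, F l i *ᵥ k = F l 0 *ᵥ k) ∧ (F l 0 *ᵥ k, k) ∈ P) :
    ∃ M : Tup n a b → ℂ, Differentiable ℂ M ∧ M (F l0) ≠ 0 ∧
      ∀ G ∈ closure (F '' Ω), M G ≠ 0 → ∀ u v, (∀ i, G i *ᵥ v = u) → (u, v) ∈ P := by
  obtain ⟨S, p0, hS, h1, h2, h3⟩ := exists_S (F l0)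
  refine ⟨fun F => (S F).det, det_diff.comp hS, by simp [h1], ?_⟩
  have hdet : ∀ᶠ l in 𝓝 l0, (S (F l)).det ≠ 0 := by
    have hcont : ContinuousAt (fun l => (S (F l)).det) l0 :=
      ((det_diff.comp hS).continuous.continuousAt).comp
        ((hF.differentiableAt (hΩ.mem_nhds h0)).continuousAt)
    exact hcont.eventually_ne (by simp [h1])
  -- the vanishing functions
  have hvan : ∀ e ∈ kerT (F l0), ∀ ψ : Module.Dual ℂ ((Fin a → ℂ) × (Fin b → ℂ)),
      P ≤ LinearMap.ker ψ → ∀ G ∈ closure (F '' Ω),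
      ψ (G 0 *ᵥ ((S G).adjugate *ᵥ e), (S G).adjugate *ᵥ e) = 0 := by
    intro e he ψ hψ
    set Φ : Tup n a b → ℂ := fun G =>
      ψ (G 0 *ᵥ ((S G).adjugate *ᵥ e), (S G).adjugate *ᵥ e) with hΦ
    have hΦd : Differentiable ℂ Φ := by
      have hc : Differentiable ℂ ψ := ψ.toContinuousLinearMap.differentiable
      have hadj : ∀ j, Differentiable ℂ (fun G : Tup n a b => ((S G).adjugate *ᵥ e) j) := by
        intro j
        unfold mulVec dotProduct
        have : ∀ k, Differentiable ℂ (fun G : Tup n a b => (S G).adjugate j k) :=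
          fun k => (adj_diff j k).comp hS
        fun_prop
      refine hc.comp (Differentiable.prodMk (differentiable_pi.2 fun j => ?_)
        (differentiable_pi.2 hadj))
      have := fun k => diff_entry (n := n) (a := a) (b := b) 0 j k
      exact Differentiable.fun_sum (u := Finset.univ) fun k _ => (this k).fun_mul (hadj k)
    have hev : ∀ᶠ l in 𝓝 l0, Φ (F l) = 0 := by
      filter_upwards [hdet, hyp] with l hl hE
      obtain ⟨E, hE1, hE2⟩ := hE
      have hsub : E ≤ kerT (F l) := fun k hk => mem_kerT.2 (hE2 k hk).1
      have hunit : IsUnit (S (F l)) := (isUnit_iff_isUnit_det _).2 (isUnit_iff_ne_zero.2 hl)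
      have hmap : E.map (mulVecLin (S (F l))) = kerT (F l0) := by
        apply Submodule.eq_of_le_of_finrank_le
        · rintro _ ⟨k, hk, rfl⟩
          rw [mulVecLin_apply, h3 _ k (hsub hk)]; exact h2 k
        · rw [(E.equivMapOfInjective (mulVecLin (S (F l)))
            (mulVec_injective_of_isUnit hunit)).symm.finrank_eq]
          exact hE1
      have he' : e ∈ E.map (mulVecLin (S (F l))) := hmap ▸ he
      obtain ⟨k, hk, hke⟩ := he'
      have : (S (F l)).adjugate *ᵥ e = (S (F l)).det • k := by
        rw [← hke, mulVecLin_apply, mulVec_mulVec, adjugate_mul, smul_mulVec, one_mulVec]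
      have hP : ((S (F l)).det • (F l 0 *ᵥ k, k)) ∈ P := P.smul_mem _ (hE2 k hk).2
      have := hψ hP
      simp only [hΦ]
      rw [‹(S (F l)).adjugate *ᵥ e = _›, mulVec_smul]
      exact this
    have hid : Set.EqOn (fun l => Φ (F l)) 0 Ω :=
      AnalyticOnNhd.eqOn_zero_of_preconnected_of_eventuallyEq_zero
        ((hΦd.comp_differentiableOn hF).analyticOnNhd hΩ) hc h0 hev
    have hcl : IsClosed {G | Φ G = 0} := isClosed_eq hΦd.continuous continuous_const
    intro G hG
    exact closure_minimal (by rintro _ ⟨l, hl, rfl⟩; exact hid hl) hcl hG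
  intro G hG hM u v huv
  by_contra hcon
  have hcon' : (S G).det • (u, v) ∉ P := by
    intro h
    exact hcon ((P.smul_mem_iff hM).1 h)
  obtain ⟨ψ, hψ1, hψ2⟩ := Submodule.exists_le_ker_of_notMem hcon'
  apply hψ1
  have hk : v ∈ kerT G := mem_kerT.2 fun i => by rw [huv, huv]
  have := hvan (p0 v) (h2 v) ψ hψ2 G hG
  rw [← h3 G v hk, mulVec_mulVec _ (S G).adjugate, adjugate_mul, smul_mulVec, one_mulVec,
    mulVec_smul, huv] at this
  exact this

theorem lemmaQ {n a b : ℕ} (F0 : Tup n a b) (R : Submodule ℂ ((Fin a → ℂ) × (Fin b → ℂ)))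
    (hR : ∀ k, (F0 0 *ᵥ k, k) ∈ R → k = 0) :
    ∃ Q : Tup n a b → ℂ, Differentiable ℂ Q ∧ Q F0 ≠ 0 ∧
      ∀ G u v, Q G ≠ 0 → G 0 *ᵥ v = u → (u, v) ∈ R → v = 0 := by
  obtain ⟨Ψ, hΨ⟩ := LinearMap.exists_leftInverse_of_injective
    (R.mkQ ∘ₗ ((mulVecLin (F0 0)).prod LinearMap.id)) (by
    rw [LinearMap.ker_eq_bot']
    intro k hk
    apply hR
    simpa using hk)
  refine ⟨fun G => (LinearMap.toMatrix' (Ψ ∘ₗ R.mkQ ∘ₗ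
    ((mulVecLin (G 0)).prod LinearMap.id))).det, ?_, ?_, ?_⟩
  · refine det_diff.comp (diff_mat fun x y => ?_)
    simp only [LinearMap.toMatrix'_apply]
    have hc : Differentiable ℂ (Ψ ∘ₗ R.mkQ) :=
      (Ψ ∘ₗ R.mkQ).toContinuousLinearMap.differentiable
    have hd : Differentiable ℂ (fun G : Tup n a b =>
        ((G 0 *ᵥ (Pi.single y 1), Pi.single y 1) : (Fin a → ℂ) × (Fin b → ℂ))) := by
      refine Differentiable.prodMk ?_ (differentiable_const _)
      refine differentiable_pi.2 fun z => ?_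
      simp only [mulVec_single_one, col_apply]
      exact (diff_entry 0 z y)
    exact differentiable_pi.1 (hc.comp hd) x
  · simp only [hΨ]
    rw [LinearMap.toMatrix'_id]; simp
  · intro G u v hQ hu hR
    have : LinearMap.toMatrix' (Ψ ∘ₗ R.mkQ ∘ₗ ((mulVecLin (G 0)).prod LinearMap.id)) *ᵥ v = 0 := by
      rw [LinearMap.toMatrix'_mulVec]
      have : R.mkQ (u, v) = 0 := by simpa using hR
      rw [← hu] at this
      exact (congrArg Ψ this).trans (map_zero Ψ)
    by_contra hv
    exact hQ (exists_mulVec_eq_zero_iff.1 ⟨v, hv, this⟩)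

theorem fin_tuple {V W : Type*} [AddCommGroup V] [Module ℂ V] [FiniteDimensional ℂ V] [Inhabited W]
    (A : W → Submodule ℂ V) : ∀ (n : ℕ) (B : Submodule ℂ V), finrank ℂ B ≤ n →
    ∃ w : Fin n → W, ∀ k ∈ B, (∀ i, k ∈ A (w i)) → ∀ x, k ∈ A x := by
  intro n
  induction n with
  | zero =>
    intro B hB
    have : B = ⊥ := Submodule.finrank_eq_zero.1 (by omega)
    refine ⟨fun i => default, fun k hk _ x => ?_⟩
    rw [this, Submodule.mem_bot] at hk
    rw [hk]; exact (A x).zero_mem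
  | succ n ih =>
    intro B hB
    by_cases h : ∀ x, B ≤ A x
    · exact ⟨fun _ => default, fun k hk _ x => h x hk⟩
    · push Not at h
      obtain ⟨x, hx⟩ := h
      have hlt : B ⊓ A x < B := lt_of_le_of_ne inf_le_left fun h => hx (inf_eq_left.1 h)
      have := Submodule.finrank_lt_finrank_of_lt hlt
      obtain ⟨w, hw⟩ := ih (B ⊓ A x) (by omega)
      refine ⟨Fin.cons x w, fun k hk hi y => hw k ⟨hk, ?_⟩ (fun i => ?_) y⟩
      · simpa using hi 0
      · simpa using hi i.succ

end

section

open Module Topology Filter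

theorem coord_le {a : ℕ} {u : Fin a → ℂ} (h : nsq u = 1) (i : Fin a) : ‖u i‖ ≤ 1 := by
  have := Finset.single_le_sum (f := fun i => ‖u i‖ ^ 2)
      (fun _ _ => by positivity) (Finset.mem_univ i)
  have h' : ∑ i, ‖u i‖ ^ 2 = 1 := h
  rw [h'] at this
  nlinarith [norm_nonneg (u i)]

theorem tend_mulVec {a b : ℕ} {B : ℕ → Matrix (Fin a) (Fin b) ℂ} {A : Matrix (Fin a) (Fin b) ℂ}
    (hB : ∀ x y, Tendsto (fun k => B k x y) atTop (𝓝 (A x y))) {v : ℕ → Fin b → ℂ}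
    {v' : Fin b → ℂ} (hv : Tendsto v atTop (𝓝 v')) {u : ℕ → Fin a → ℂ}
    {u' : Fin a → ℂ} (hu : Tendsto u atTop (𝓝 u')) :
    Tendsto (fun k => nsq (B k *ᵥ v k - u k)) atTop (𝓝 (nsq (A *ᵥ v' - u'))) := by
  refine (nsq_continuous.tendsto _).comp (Tendsto.sub (tendsto_pi_nhds.2 fun x => ?_) hu)
  exact tendsto_finsetSum Finset.univ fun y _ => (hB x y).mul (tendsto_pi_nhds.1 hv y)

theorem lemmaBd {n a b : ℕ} {h : ℂ → ℝ} (hh : Continuous h)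
    (hb : Bornology.IsBounded {l | h l < 1}) {l0 : ℂ} (h0 : h l0 < 1) {F : ℂ → Tup n a b}
    (hF : DifferentiableOn ℂ F {l | h l < 1})
    (hcon : ∀ l, h l < 1 → ∀ i x, nsq (F l i *ᵥ x) ≤ nsq x)
    {G : Tup n a b → ℂ} (hG : Differentiable ℂ G) (hG0 : G (F l0) ≠ 0)
    (happ : ∀ η > 0, ∃ ρ < 1, ∀ l, ρ ≤ h l → h l < 1 → ∃ u v, nsq u = 1 ∧ nsq v = 1 ∧
      ∀ i, nsq (F l i *ᵥ v - u) ≤ η) :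
    ∃ A ∈ closure (F '' {l | h l < 1}), ∃ u v, nsq u = 1 ∧ nsq v = 1 ∧
      (∀ i, A i *ᵥ v = u) ∧ (∀ i, (A i)ᴴ *ᵥ u = v) ∧ G A ≠ 0 := by
  have hk : ∀ k : ℕ, ∃ l u v, h l < 1 ∧ ‖G (F l0)‖ ≤ ‖G (F l)‖ ∧ nsq u = 1 ∧ nsq v = 1 ∧
      ∀ i, nsq (F l i *ᵥ v - u) ≤ 1 / ((k : ℝ) + 1) := by
    intro k
    obtain ⟨ρ, hρ, hu⟩ := happ (1 / ((k : ℝ) + 1)) (by positivity)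
    set ρ' := max ρ ((h l0 + 1) / 2) with hρ'
    have h1 : ρ' < 1 := max_lt hρ (by linarith)
    have h2 : h l0 < ρ' := lt_of_lt_of_le (by linarith) (le_max_right _ _)
    have hcl : closure {l | h l < ρ'} ⊆ {l | h l < 1} := fun l hl =>
      lt_of_le_of_lt (closure_lt_subset_le hh continuous_const hl) h1
    obtain ⟨z, hz, hmax⟩ := Complex.exists_mem_frontier_isMaxOn_norm
      (f := fun l => G (F l)) (U := {l | h l < ρ'})
      (hb.subset fun l (hl : h l < ρ') => hl.trans h1) ⟨l0, h2⟩
      (DifferentiableOn.diffContOnCl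
        ((hG.comp_differentiableOn hF).mono hcl))
    have hz' : h z = ρ' := frontier_lt_subset_eq hh continuous_const hz
    obtain ⟨u, v, hu1, hv1, huv⟩ := hu z (hz' ▸ le_max_left _ _) (hz' ▸ h1)
    exact ⟨z, u, v, hz' ▸ h1, hmax (subset_closure h2), hu1, hv1, huv⟩
  choose l u v hl hGl hu hv huv using hk
  have i1 : ProperSpace (Tup n a b) :=
    (inferInstance : ProperSpace (Fin (n + 1) → Fin a → Fin b → ℂ))
  have i2 : FirstCountableTopology (Tup n a b) :=
    (inferInstance : FirstCountableTopology (Fin (n + 1) → Fin a → Fin b → ℂ))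
  have hcomp : IsCompact (Metric.closedBall (0 : Tup n a b × (Fin a → ℂ) × (Fin b → ℂ)) 1) :=
    isCompact_closedBall _ _
  obtain ⟨⟨A, u', v'⟩, -, φ, hφ, hlim⟩ := hcomp.tendsto_subseq
    (x := fun k => (F (l k), u k, v k)) (fun k => by
      rw [mem_closedBall_zero_iff, Prod.norm_mk, Prod.norm_mk, max_le_iff, max_le_iff]
      refine ⟨?_, ?_, ?_⟩
      · refine (pi_norm_le_iff_of_nonneg zero_le_one).2 fun i => ?_
        refine (pi_norm_le_iff_of_nonneg zero_le_one).2 fun x => ?_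
        refine (pi_norm_le_iff_of_nonneg zero_le_one).2 fun y => ?_
        exact entry_le (hcon (l k) (hl k) i) x y
      · exact (pi_norm_le_iff_of_nonneg zero_le_one).2 (coord_le (hu k))
      · exact (pi_norm_le_iff_of_nonneg zero_le_one).2 (coord_le (hv k)))
  have hA : Tendsto (fun k => F (l (φ k))) atTop (𝓝 A) := (continuous_fst.tendsto _).comp hlim
  have hu' : Tendsto (fun k => u (φ k)) atTop (𝓝 u') :=
    ((continuous_fst.comp continuous_snd).tendsto _).comp hlim
  have hv' : Tendsto (fun k => v (φ k)) atTop (𝓝 v') :=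
    ((continuous_snd.comp continuous_snd).tendsto _).comp hlim
  have hAi : ∀ i, Tendsto (fun k => F (l (φ k)) i) atTop (𝓝 (A i)) := fun i =>
    ((continuous_apply i).tendsto _).comp hA
  have hmul : ∀ i x, Tendsto (fun k => nsq (F (l (φ k)) i *ᵥ x)) atTop (𝓝 (nsq (A i *ᵥ x))) := by
    intro i x
    have hc : Continuous (fun B : Matrix (Fin a) (Fin b) ℂ => nsq (B *ᵥ x)) :=
      nsq_continuous.comp (Continuous.matrix_mulVec continuous_id continuous_const)
    exact (hc.tendsto _).comp (hAi i)
  have hu1 : nsq u' = 1 := tendsto_nhds_unique ((nsq_continuous.tendsto _).comp hu')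
    (tendsto_const_nhds.congr fun k => (hu (φ k)).symm)
  have hv1 : nsq v' = 1 := tendsto_nhds_unique ((nsq_continuous.tendsto _).comp hv')
    (tendsto_const_nhds.congr fun k => (hv (φ k)).symm)
  have hcA : ∀ i x, nsq (A i *ᵥ x) ≤ nsq x := fun i x =>
    le_of_tendsto (hmul i x) (Eventually.of_forall fun k => hcon _ (hl _) i x)
  have hAv : ∀ i, A i *ᵥ v' = u' := by
    intro i
    have ht := tend_mulVec (fun x y => ((diff_entry i x y).continuous.tendsto _).comp hA) hv' hu'
    have h1 : nsq (A i *ᵥ v' - u') ≤ 0 :=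
      le_of_tendsto_of_tendsto ht (tendsto_one_div_add_atTop_nhds_zero_nat.comp hφ.tendsto_atTop)
        (Eventually.of_forall fun k => huv (φ k) i)
    exact sub_eq_zero.1 (nsq_eq_zero (le_antisymm h1 (nsq_nonneg _)))
  refine ⟨A, ?_, u', v', hu1, hv1, hAv, ?_, ?_⟩
  · exact mem_closure_of_tendsto hA (Eventually.of_forall fun k => ⟨l (φ k), hl _, rfl⟩)
  · intro i
    have := contr_adj (hcA i) (v := v') (by rw [hAv, hu1, hv1])
    rwa [hAv] at this
  · have ht : Tendsto (fun k => ‖G (F (l (φ k)))‖) atTop (𝓝 ‖G A‖) :=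
      ((hG.continuous.norm).tendsto _).comp hA
    have := ge_of_tendsto ht (Eventually.of_forall fun k => hGl (φ k))
    exact norm_pos_iff.1 (lt_of_lt_of_le (norm_pos_iff.2 hG0) this)

theorem unit_scale {a : ℕ} {x : Fin a → ℂ} (hx : x ≠ 0) :
    ∃ c : ℝ, 0 < c ∧ nsq ((c : ℂ) • x) = 1 := by
  have h := nsq_pos hx
  refine ⟨(Real.sqrt (nsq x))⁻¹, by positivity, ?_⟩
  rw [nsq_smul, Complex.norm_real, Real.norm_of_nonneg (by positivity), inv_pow,
    Real.sq_sqrt h.le, inv_mul_cancel₀ h.ne']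

theorem proper_unit {p q a b : ℕ} {f : Matrix (Fin p) (Fin q) ℂ → Matrix (Fin a) (Fin b) ℂ}
    (hfp : ProperOn f (typeIDomain p q) (typeIDomain a b)) {r : ℝ} (hr0 : 0 ≤ r) (hr : r < 1) :
    ∃ ρ < 1, ∀ Z ∈ typeIDomain p q, ∀ x, nsq x = 1 → ρ ≤ nsq (Z *ᵥ x) →
      ∃ v, nsq v = 1 ∧ r < nsq (f Z *ᵥ v) := by
  set K : Set (Matrix (Fin a) (Fin b) ℂ) := {W | ∀ v, nsq (W *ᵥ v) ≤ r * nsq v} with hK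
  have hKcl : IsClosed K := by
    have : K = ⋂ v, {W | nsq (W *ᵥ v) ≤ r * nsq v} := by ext; simp [hK]
    rw [this]
    refine isClosed_iInter fun v => isClosed_le ?_ continuous_const
    exact nsq_continuous.comp (Continuous.matrix_mulVec continuous_id continuous_const)
  have hKc : IsCompact K := by
    refine (isCompact_closedBall (0 : Matrix (Fin a) (Fin b) ℂ) 1).of_isClosed_subset hKcl ?_
    intro W hW
    rw [mem_closedBall_zero_iff]
    refine (pi_norm_le_iff_of_nonneg zero_le_one).2 fun x => ?_
    refine (pi_norm_le_iff_of_nonneg zero_le_one).2 fun y => ?_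
    exact entry_le (fun z => (hW z).trans (by nlinarith [nsq_nonneg z])) x y
  have hKD : K ⊆ typeIDomain a b := fun W hW => mem_dom.2 fun x hx =>
    lt_of_le_of_lt (hW x) (by nlinarith [nsq_pos hx])
  have hC := hfp.2 K hKD hKc
  have hS : IsCompact {x : Fin q → ℂ | nsq x = 1} := by
    refine (isCompact_closedBall (0 : Fin q → ℂ) 1).of_isClosed_subset
      (isClosed_eq nsq_continuous continuous_const) ?_
    intro x hx
    rw [mem_closedBall_zero_iff]
    exact (pi_norm_le_iff_of_nonneg zero_le_one).2 (coord_le hx)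
  have hm : ∃ ρ < 1, ∀ Z ∈ typeIDomain p q ∩ f ⁻¹' K, ∀ x, nsq x = 1 → nsq (Z *ᵥ x) < ρ := by
    have hCS := hC.prod hS
    rcases ((typeIDomain p q ∩ f ⁻¹' K) ×ˢ {x : Fin q → ℂ | nsq x = 1}).eq_empty_or_nonempty
      with he | hne
    · refine ⟨0, by norm_num, fun Z hZ x hx => ?_⟩
      have : (Z, x) ∈ ((typeIDomain p q ∩ f ⁻¹' K) ×ˢ {x : Fin q → ℂ | nsq x = 1}) := ⟨hZ, hx⟩
      rw [he] at this; exact this.elim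
    · obtain ⟨⟨Z0, x0⟩, ⟨hZ0, hx0⟩, hmax⟩ := hCS.exists_isMaxOn hne
        (f := fun y => nsq (y.1 *ᵥ y.2))
        (nsq_continuous.comp (Continuous.matrix_mulVec continuous_fst continuous_snd)).continuousOn
      have hx0' : nsq x0 = 1 := hx0
      have h1 : nsq (Z0 *ᵥ x0) < 1 := by
        rw [← hx0']
        refine mem_dom.1 hZ0.1 x0 ?_
        rintro rfl; simp [nsq_zero] at hx0'
      refine ⟨(nsq (Z0 *ᵥ x0) + 1) / 2, by linarith, fun Z hZ x hx => ?_⟩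
      have : nsq (Z *ᵥ x) ≤ nsq (Z0 *ᵥ x0) := isMaxOn_iff.1 hmax (Z, x) (Set.mk_mem_prod hZ hx)
      linarith
  obtain ⟨ρ, hρ, h⟩ := hm
  refine ⟨ρ, hρ, fun Z hZ x hx hle => ?_⟩
  have hn : f Z ∉ K := fun hk => absurd (h Z ⟨hZ, hk⟩ x hx) (not_lt.2 hle)
  have : ∃ v, r * nsq v < nsq (f Z *ᵥ v) := by
    by_contra hcon
    push Not at hcon
    exact hn hcon
  obtain ⟨v, hv⟩ := this
  have hv0 : v ≠ 0 := by rintro rfl; simp [nsq_zero] at hv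
  obtain ⟨c, hc, hcv⟩ := unit_scale hv0
  refine ⟨(c : ℂ) • v, hcv, ?_⟩
  rw [mulVec_smul, nsq_smul]
  rw [nsq_smul] at hcv
  have hc2 : 0 < ‖(c : ℂ)‖ ^ 2 := by
    rw [Complex.norm_real, Real.norm_of_nonneg hc.le]; positivity
  calc r = r * (‖(c : ℂ)‖ ^ 2 * nsq v) := by rw [hcv, mul_one]
    _ = ‖(c : ℂ)‖ ^ 2 * (r * nsq v) := by ring
    _ < _ := by gcongr

theorem approx_hyp {p q a b : ℕ} {f : Matrix (Fin p) (Fin q) ℂ → Matrix (Fin a) (Fin b) ℂ}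
    (hf : DifferentiableOn ℂ f (typeIDomain p q))
    (hfp : ProperOn f (typeIDomain p q) (typeIDomain a b)) {n : ℕ} {R : ℝ} (hR : 1 < R)
    {Z : ℂ → Tup n p q} {h : ℂ → ℝ}
    (hZ : ∀ l, h l < 1 → ∀ i (s : ℂ), ‖s‖ < R → Z l 0 + s • (Z l i - Z l 0) ∈ typeIDomain p q)
    (hx : ∀ ρ < 1, ∃ ρ' < 1, ∀ l, ρ' ≤ h l → h l < 1 → ∃ x, nsq x = 1 ∧ ρ ≤ nsq (Z l 0 *ᵥ x)) :
    ∀ η > 0, ∃ ρ < 1, ∀ l, ρ ≤ h l → h l < 1 → ∃ u v, nsq u = 1 ∧ nsq v = 1 ∧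
      ∀ i, nsq (f (Z l i) *ᵥ v - u) ≤ η := by
  intro η hη
  set δ : ℝ := min (1 / 2) (η * (R - 1) / (2 * (R + 1))) with hδ
  have hRp : 0 < R - 1 := by linarith
  have hδ0 : 0 < δ := lt_min (by norm_num) (by positivity)
  have hδ1 : δ ≤ 1 / 2 := min_le_left _ _
  have hδ2 : 2 * (δ * (R + 1)) ≤ η * (R - 1) := by
    have : δ ≤ η * (R - 1) / (2 * (R + 1)) := min_le_right _ _
    rw [le_div_iff₀ (by linarith)] at this
    linarith
  obtain ⟨ρ, hρ, hv⟩ := proper_unit hfp (r := 1 - δ) (by linarith) (by linarith)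
  obtain ⟨ρ', hρ', hx'⟩ := hx ρ hρ
  refine ⟨ρ', hρ', fun l hl1 hl2 => ?_⟩
  obtain ⟨x, hx1, hx2⟩ := hx' l hl1 hl2
  have hZ0 : Z l 0 ∈ typeIDomain p q := by
    simpa using hZ l hl2 0 0 (by simp; linarith)
  obtain ⟨v, hv1, hv2⟩ := hv (Z l 0) hZ0 x hx1 hx2
  set α := Real.sqrt (nsq (f (Z l 0) *ᵥ v)) with hα
  have hα2 : α ^ 2 = nsq (f (Z l 0) *ᵥ v) := Real.sq_sqrt (nsq_nonneg _)
  have hαpos : 0 < α := Real.sqrt_pos.2 (by linarith)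
  have hle : nsq (f (Z l 0) *ᵥ v) ≤ 1 := hv1 ▸ contr_le (hfp.1 hZ0) v
  have hα1 : 1 - α ≤ δ := by nlinarith
  have hαc : (α : ℂ) ≠ 0 := by exact_mod_cast hαpos.ne'
  have hu : nsq ((α : ℂ)⁻¹ • (f (Z l 0) *ᵥ v)) = 1 := by
    rw [nsq_smul, norm_inv, Complex.norm_real, Real.norm_of_nonneg hαpos.le, ← hα2, inv_pow,
      inv_mul_cancel₀ (by positivity)]
  refine ⟨(α : ℂ)⁻¹ • (f (Z l 0) *ᵥ v), v, hu, hv1, fun i => ?_⟩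
  have hmaps : ∀ s ∈ Metric.ball (0 : ℂ) R, Z l 0 + s • (Z l i - Z l 0) ∈ typeIDomain p q :=
    fun s hs => hZ l hl2 i s (by simpa using hs)
  have key := line_approx (g := fun s => f (Z l 0 + s • (Z l i - Z l 0))) hR
    (hf.comp (by fun_prop) hmaps) (fun s hs => hfp.1 (hmaps s hs)) hαpos hv1 hu
    (by simp [smul_smul, hαc])
  simp only [one_smul, add_sub_cancel] at key
  have h3 : 2 * ((1 - α) * (R + 1)) ≤ 2 * (δ * (R + 1)) := by
    have : 0 < R + 1 := by linarith
    gcongr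
  exact le_of_mul_le_mul_right (key.trans (h3.trans hδ2)) hRp

end

section

open Module Topology Filter

/-- rectangular diagonal matrix -/
def dg (p : ℕ) {q : ℕ} (ζ : Fin q → ℂ) : Matrix (Fin p) (Fin q) ℂ :=
  fun i j => if i.val = j.val then ζ j else 0

theorem dg_nsq {p q : ℕ} (hqp : q ≤ p) (ζ x : Fin q → ℂ) :
    nsq (dg p ζ *ᵥ x) = ∑ j, ‖ζ j‖ ^ 2 * ‖x j‖ ^ 2 := by
  symm
  refine Finset.sum_of_injOn (Fin.castLE hqp) ?_ ?_ ?_ ?_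
  · exact (Fin.castLE_injective hqp).injOn
  · intro _ _; simp
  · intro i _ hi
    have : (dg p ζ *ᵥ x) i = 0 := by
      unfold mulVec dotProduct
      refine Finset.sum_eq_zero fun j _ => ?_
      have : i.val ≠ j.val := fun h => hi ⟨j, by simp, Fin.ext h.symm⟩
      simp [dg, this]
    simp [this]
  · intro j _
    have : (dg p ζ *ᵥ x) (Fin.castLE hqp j) = ζ j * x j := by
      unfold mulVec dotProduct
      rw [Finset.sum_eq_single j]
      · simp [dg]
      · intro k _ hk
        have : (j : ℕ) ≠ k := fun h => hk (Fin.ext h.symm)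
        simp [dg, this]
      · simp
    rw [this, norm_mul, mul_pow]

theorem dg_mem {p q : ℕ} (hqp : q ≤ p) {ζ : Fin q → ℂ} (h : ‖ζ‖ < 1) :
    dg p ζ ∈ typeIDomain p q := by
  refine mem_dom.2 fun x hx => ?_
  rw [dg_nsq hqp]
  obtain ⟨j, hj⟩ : ∃ j, x j ≠ 0 := Function.ne_iff.1 hx
  have h1 : ∀ j, ‖ζ j‖ < 1 := fun j => (norm_le_pi_norm ζ j).trans_lt h
  have h2 : ∀ j, ‖ζ j‖ ^ 2 < 1 := fun j => by nlinarith [h1 j, norm_nonneg (ζ j)]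
  refine Finset.sum_lt_sum (fun j _ => ?_) ⟨j, Finset.mem_univ _, ?_⟩
  · nlinarith [h2 j, sq_nonneg ‖x j‖]
  · have : 0 < ‖x j‖ ^ 2 := by have := norm_pos_iff.2 hj; positivity
    nlinarith [h2 j]

/-- graph -/
noncomputable def Gr {a b : ℕ} (F : Matrix (Fin a) (Fin b) ℂ) :
    Submodule ℂ ((Fin a → ℂ) × (Fin b → ℂ)) :=
  LinearMap.range ((mulVecLin F).prod LinearMap.id)

theorem mem_Gr {a b : ℕ} {F : Matrix (Fin a) (Fin b) ℂ} {x : Fin a → ℂ} {k : Fin b → ℂ} :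
    (x, k) ∈ Gr F ↔ F *ᵥ k = x := by
  unfold Gr
  constructor
  · rintro ⟨y, hy⟩
    have h1 : F *ᵥ y = x := congrArg Prod.fst hy
    have h2 : y = k := congrArg Prod.snd hy
    rw [← h2, h1]
  · rintro rfl; exact ⟨k, rfl⟩

theorem finrank_Gr {a b : ℕ} (F : Matrix (Fin a) (Fin b) ℂ) : finrank ℂ (Gr F) ≤ b := by
  have := LinearMap.finrank_range_le ((mulVecLin F).prod LinearMap.id)
  exact this.trans_eq (by simp)

theorem upd_norm {q : ℕ} {ζ : Fin q → ℂ} (h : ‖ζ‖ < 1) {z : ℂ} (hz : ‖z‖ < 1) (j : Fin q) :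
    ‖Function.update ζ j z‖ < 1 := by
  rw [pi_norm_lt_iff one_pos] at h ⊢
  intro i
  by_cases hi : i = j
  · subst hi; simpa using hz
  · simpa [hi] using h i

theorem coreA {p q a b : ℕ} (hqp : q ≤ p)
    {f : Matrix (Fin p) (Fin q) ℂ → Matrix (Fin a) (Fin b) ℂ}
    (hf : DifferentiableOn ℂ f (typeIDomain p q))
    (hfp : ProperOn f (typeIDomain p q) (typeIDomain a b)) (j : Fin q)
    (P : Submodule ℂ ((Fin a → ℂ) × (Fin b → ℂ)))
    (hP : ∀ z : ℂ, ‖z‖ < 1 → ∀ k, (∀ ζ : Fin q → ℂ, ‖ζ‖ < 1 →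
      f (dg p (Function.update ζ j z)) *ᵥ k = f (dg p (Function.update 0 j z)) *ᵥ k) →
      (f (dg p (Function.update 0 j z)) *ᵥ k, k) ∈ P) :
    ∃ u v, nsq u = 1 ∧ nsq v = 1 ∧ (u, v) ∈ P := by
  set W := {ζ : Fin q → ℂ // ‖ζ‖ < 1} with hW
  haveI : Inhabited W := ⟨⟨0, by simp⟩⟩
  set A : ℂ → W → Submodule ℂ (Fin b → ℂ) := fun z ζ => LinearMap.ker (mulVecLin
    (f (dg p (Function.update ζ.1 j z)) - f (dg p (Function.update 0 j z)))) with hA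
  have memA : ∀ z ζ k, k ∈ A z ζ ↔ f (dg p (Function.update ζ.1 j z)) *ᵥ k =
      f (dg p (Function.update 0 j z)) *ᵥ k := by
    intro z ζ k
    simp [hA, sub_mulVec, sub_eq_zero]
  set E : ℂ → Submodule ℂ (Fin b → ℂ) := fun z => ⨅ ζ, A z ζ with hE
  obtain ⟨z0, hz0, hmin⟩ : ∃ z0 : ℂ, ‖z0‖ < 1 ∧ ∀ z : ℂ, ‖z‖ < 1 →
      finrank ℂ (E z0) ≤ finrank ℂ (E z) := by
    have hne : ({z : ℂ | ‖z‖ < 1}).Nonempty := ⟨0, by simp⟩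
    obtain ⟨z0, h1, h2⟩ := exists_minimalFor_of_wellFoundedLT (fun z : ℂ => ‖z‖ < 1)
      (fun z => finrank ℂ (E z)) hne
    refine ⟨z0, h1, fun z hz => ?_⟩
    rcases le_total (finrank ℂ (E z0)) (finrank ℂ (E z)) with h | h
    · exact h
    · exact h2 hz h
  obtain ⟨w, hw⟩ := fin_tuple (A z0) b ⊤ (by simp)
  set pts : Fin (b + 1) → (Fin q → ℂ) := Fin.cons 0 (fun i => (w i).1) with hpts
  set Z : ℂ → Tup b p q := fun l i => dg p (Function.update (pts i) j l) with hZ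
  set F : ℂ → Tup b a b := fun l i => f (Z l i) with hFd
  have hpts1 : ∀ i, ‖pts i‖ < 1 := by
    intro i
    refine Fin.cases ?_ (fun i => ?_) i
    · simp [hpts]
    · simpa [hpts] using (w i).2
  have hm : ‖pts‖ < 1 := (pi_norm_lt_iff one_pos).2 hpts1
  have hopen : {l : ℂ | ‖l‖ < 1} = Metric.ball 0 1 := by ext; simp
  have hZmem : ∀ l : ℂ, ‖l‖ < 1 → ∀ i, Z l i ∈ typeIDomain p q := fun l hl i =>
    dg_mem hqp (upd_norm (hpts1 i) hl j)
  have hZd : ∀ i, Differentiable ℂ (fun l => Z l i) := by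
    intro i
    refine diff_mat fun x y => ?_
    simp only [hZ, dg, Function.update_apply]
    split_ifs <;> fun_prop
  have hFdiff : DifferentiableOn ℂ F {l | ‖l‖ < 1} := by
    refine differentiableOn_pi.2 fun i => ?_
    exact hf.comp (hZd i).differentiableOn fun l hl => hZmem l hl i
  have hker : kerT (F z0) ≤ E z0 := by
    intro k hk
    rw [mem_kerT] at hk
    refine (Submodule.mem_iInf _).2 (hw k trivial fun i => ?_)
    rw [memA]
    simpa [hFd, hZ, hpts] using hk i.succ
  obtain ⟨M, hMd, hM0, hM⟩ := lemmaK (Ω := {l : ℂ | ‖l‖ < 1}) (hopen ▸ Metric.isOpen_ball)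
    (hopen ▸ (convex_ball (0 : ℂ) 1).isPreconnected) hz0 hFdiff P (by
      have hnh : {l : ℂ | ‖l‖ < 1} ∈ 𝓝 z0 := (hopen ▸ Metric.isOpen_ball :
        IsOpen {l : ℂ | ‖l‖ < 1}).mem_nhds hz0
      filter_upwards [hnh] with l hl
      refine ⟨E l, (Submodule.finrank_mono hker).trans (hmin l hl), fun k hk => ?_⟩
      have hk' : ∀ ζ : Fin q → ℂ, ‖ζ‖ < 1 → f (dg p (Function.update ζ j l)) *ᵥ k =
          f (dg p (Function.update 0 j l)) *ᵥ k := fun ζ hζ =>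
        (memA l ⟨ζ, hζ⟩ k).1 ((Submodule.mem_iInf _).1 hk _)
      have h0 : pts 0 = 0 := by simp [hpts]
      refine ⟨fun i => ?_, ?_⟩
      · simp only [hFd, hZ, h0]
        exact hk' _ (hpts1 i)
      · simp only [hFd, hZ, h0]
        exact hP l hl k hk')
  have hR : 1 < 2 / (1 + ‖pts‖) := by
    rw [lt_div_iff₀ (by positivity)]; linarith
  obtain ⟨B, hB, u, v, hu, hv, hBv, -, hMB⟩ := lemmaBd (h := fun l : ℂ => ‖l‖) continuous_norm
    (hopen ▸ Metric.isBounded_ball) hz0 hFdiff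
    (fun l hl i x => contr_le (hfp.1 (hZmem l hl i)) x) hMd hM0
    (approx_hyp hf hfp hR (Z := Z) (h := fun l : ℂ => ‖l‖) (by
      intro l hl i s hs
      have : Z l 0 + s • (Z l i - Z l 0) = dg p (Function.update (s • pts i) j l) := by
        ext x y
        simp only [hZ, hpts, dg, Matrix.add_apply, Matrix.smul_apply, Matrix.sub_apply,
          Function.update_apply, Fin.cons_zero, Pi.zero_apply, Pi.smul_apply, smul_eq_mul]
        split_ifs <;> ring
      rw [this]
      refine dg_mem hqp (upd_norm ?_ hl j)
      rw [norm_smul]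
      have h1 : ‖pts i‖ ≤ ‖pts‖ := norm_le_pi_norm pts i
      rw [lt_div_iff₀ (by positivity)] at hs
      nlinarith [norm_nonneg s, norm_nonneg pts, norm_nonneg (pts i)]) (by
      intro ρ hρ
      refine ⟨(1 + ρ) / 2, by linarith, fun l hl1 hl2 => ⟨Pi.single j 1, ?_, ?_⟩⟩
      · unfold nsq
        rw [Finset.sum_eq_single j]
        · simp
        · intro k _ hk; simp [Pi.single_eq_of_ne hk]
        · simp
      · simp only [hZ]
        rw [dg_nsq hqp, Finset.sum_eq_single j]
        · simp only [Function.update_self, Pi.single_eq_same, norm_one, one_pow, mul_one]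
          by_cases h : 0 ≤ (1 + ρ) / 2
          · nlinarith [sq_nonneg (1 - ρ)]
          · nlinarith [sq_nonneg ‖l‖]
        · intro k _ hk; simp [Pi.single_eq_of_ne hk]
        · simp))
  exact ⟨u, v, hu, hv, hM B hB hMB u v hBv⟩

theorem partA {p q a b : ℕ} (hqp : q ≤ p)
    {f : Matrix (Fin p) (Fin q) ℂ → Matrix (Fin a) (Fin b) ℂ}
    (hf : DifferentiableOn ℂ f (typeIDomain p q))
    (hfp : ProperOn f (typeIDomain p q) (typeIDomain a b)) : q ≤ b := by
  have key : ∀ m ≤ q, ∃ ζ : Fin q → ℂ, ‖ζ‖ < 1 ∧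
      ∃ P : Submodule ℂ ((Fin a → ℂ) × (Fin b → ℂ)), m ≤ finrank ℂ P ∧
      ∀ ζ' : Fin q → ℂ, ‖ζ'‖ < 1 → (∀ j, j.val < m → ζ' j = ζ j) → P ≤ Gr (f (dg p ζ')) := by
    intro m
    induction m with
    | zero => exact fun _ => ⟨0, by simp, ⊥, by simp, fun _ _ _ => bot_le⟩
    | succ m ih =>
      intro hm
      obtain ⟨ζ, hζ, P, hPm, hP⟩ := ih (by omega)
      set j : Fin q := ⟨m, by omega⟩ with hj
      by_contra hcon
      obtain ⟨u, v, hu, hv, huv⟩ := coreA hqp hf hfp j P (by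
        intro z hz k hk
        by_contra hn
        apply hcon
        refine ⟨Function.update ζ j z, upd_norm hζ hz j,
          P ⊔ Submodule.span ℂ {(f (dg p (Function.update 0 j z)) *ᵥ k, k)}, ?_, ?_⟩
        · have hlt : P < P ⊔ Submodule.span ℂ {(f (dg p (Function.update 0 j z)) *ᵥ k, k)} := by
            refine lt_of_le_of_ne le_sup_left fun h => hn ?_
            rw [h]
            exact (le_sup_right : _ ≤ P ⊔ _) (Submodule.mem_span_singleton_self _)
          have := Submodule.finrank_lt_finrank_of_lt hlt
          omega
        · intro ζ' hζ' hag
          refine sup_le (hP ζ' hζ' fun i hi => ?_) ?_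
          · rw [hag i (by omega), Function.update_of_ne]
            intro h; rw [h] at hi; simp [hj] at hi
          · rw [Submodule.span_singleton_le_iff_mem, mem_Gr, ← hk ζ' hζ']
            have : Function.update ζ' j z = ζ' := by
              rw [← Function.update_eq_self j ζ']
              have := hag j (by simp [hj])
              simp at this
              simp [this]
            rw [this])
      have := hP ζ hζ (fun _ _ => rfl) huv
      rw [mem_Gr] at this
      have hlt := mem_dom.1 (hfp.1 (dg_mem hqp hζ)) v (by rintro rfl; simp [nsq_zero] at hv)
      rw [this, hu, hv] at hlt
      exact lt_irrefl _ hlt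
  obtain ⟨ζ, hζ, P, hPm, hP⟩ := key q le_rfl
  exact hPm.trans ((Submodule.finrank_mono (hP ζ hζ fun _ _ => rfl)).trans (finrank_Gr _))

end

section

open Module Topology Filter

/-- Euclidean space -/
abbrev EV (p : ℕ) := EuclideanSpace ℂ (Fin p)

/-- pairs of columns forming a strict contraction -/
def Dom2 {p : ℕ} (z w : EV p) : Prop :=
  ∀ α β : ℂ, (α ≠ 0 ∨ β ≠ 0) → ‖α • z + β • w‖ ^ 2 < ‖α‖ ^ 2 + ‖β‖ ^ 2

theorem dom2_small {p : ℕ} {z w : EV p} (hz : ‖z‖ ≤ 1 / 2) (hw : ‖w‖ ≤ 1 / 2) : Dom2 z w := by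
  intro α β h
  have h1 : ‖α • z + β • w‖ ≤ (‖α‖ + ‖β‖) / 2 := by
    refine (norm_add_le _ _).trans ?_
    rw [norm_smul, norm_smul]
    nlinarith [norm_nonneg α, norm_nonneg β]
  have h2 : 0 < ‖α‖ ^ 2 + ‖β‖ ^ 2 := by
    rcases h with h | h
    · have := norm_pos_iff.2 h; positivity
    · have := norm_pos_iff.2 h; positivity
  have h3 : ‖α • z + β • w‖ ^ 2 ≤ ((‖α‖ + ‖β‖) / 2) ^ 2 := by gcongr
  nlinarith [sq_nonneg (‖α‖ - ‖β‖)]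

/-- the second coordinate along the disc -/
noncomputable def wl {p : ℕ} (a c w : EV p) (l : ℂ) : EV p :=
  w - (l * (inner ℂ a w / ((1 - ‖a‖ ^ 2 : ℝ) : ℂ))) • c

theorem wl_smul {p : ℕ} (a c w : EV p) (l s : ℂ) : wl a c (s • w) l = s • wl a c w l := by
  unfold wl
  rw [inner_smul_right, smul_sub, smul_smul]
  congr 2
  ring

theorem wl_zero {p : ℕ} (a c : EV p) (l : ℂ) : wl a c 0 l = 0 := by simp [wl]

theorem wl_at_zero {p : ℕ} (a c w : EV p) : wl a c w 0 = w := by simp [wl]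

theorem disc {p : ℕ} {a w y : EV p} (hd : Dom2 a w) (hy : inner ℂ y w = 0) {l : ℂ}
    (ha : ‖a‖ < 1)
    (hl : ‖a + l • (y - (inner ℂ a y) • a)‖ < 1) :
    Dom2 (a + l • (y - (inner ℂ a y) • a)) (wl a (y - (inner ℂ a y) • a) w l) := by
  set c := y - (inner ℂ a y) • a with hc
  set t : ℂ := inner ℂ a w with ht
  set s : ℝ := 1 - ‖a‖ ^ 2 with hs
  have hs0 : 0 < s := by nlinarith [norm_nonneg a]
  have hsc : (s : ℂ) ≠ 0 := by exact_mod_cast hs0.ne'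
  set g : EV p := t • a + (s : ℂ) • w with hg
  have haa : inner ℂ a a = ((‖a‖ ^ 2 : ℝ) : ℂ) := by
    rw [inner_self_eq_norm_sq_to_K]; push_cast; rfl
  have hag : inner ℂ a g = t := by
    rw [hg, inner_add_right, inner_smul_right, inner_smul_right, haa, ← ht, hs]
    push_cast; ring
  have hcg : inner ℂ c g = 0 := by
    rw [hc, inner_sub_left, inner_smul_left, hag, inner_conj_symm, hg, inner_add_right,
      inner_smul_right, inner_smul_right, hy]
    ring
  have hphig : inner ℂ (a + l • c) g = t := by
    rw [inner_add_left, inner_smul_left, hcg, hag]; simp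
  have hgl : ‖g‖ ^ 2 < ‖t‖ ^ 2 + s ^ 2 := by
    have := hd t s (Or.inr hsc)
    rwa [Complex.norm_real, Real.norm_of_nonneg hs0.le] at this
  intro α β hαβ
  set β' : ℂ := β / s with hβ'
  set α' : ℂ := α - β' * t with hα'
  have hβe : β = β' * s := by rw [hβ']; field_simp
  have hαe : α = α' + β' * t := by rw [hα']; ring
  have hvec : α • (a + l • c) + β • wl a c w l = α' • (a + l • c) + β' • g := by
    unfold wl
    rw [← ht, ← hs, hg, hαe]
    have hβ2 : β * (l * (t / (s : ℂ))) = β' * t * l := by rw [hβ']; ring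
    rw [smul_sub β w, smul_smul β _ c, hβ2, hβe]
    clear_value c
    module
  rw [hvec]
  have h1 : ‖α' • (a + l • c) + β' • g‖ ^ 2 = ‖α'‖ ^ 2 * ‖a + l • c‖ ^ 2 +
      2 * ((starRingEnd ℂ) α' * (β' * t)).re + ‖β'‖ ^ 2 * ‖g‖ ^ 2 := by
    rw [norm_add_sq (𝕜 := ℂ), inner_smul_left, inner_smul_right, hphig, norm_smul, norm_smul]
    simp only [RCLike.re_to_complex]
    ring
  have h2 : ‖α‖ ^ 2 + ‖β‖ ^ 2 = ‖α'‖ ^ 2 + 2 * ((starRingEnd ℂ) α' * (β' * t)).re +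
      ‖β'‖ ^ 2 * (‖t‖ ^ 2 + s ^ 2) := by
    rw [hαe, hβe, norm_mul, Complex.norm_real, Real.norm_of_nonneg hs0.le]
    simp only [← Complex.normSq_eq_norm_sq, mul_pow]
    rw [Complex.normSq_add, Complex.normSq_mul]
    have : (α' * (starRingEnd ℂ) (β' * t)).re = ((starRingEnd ℂ) α' * (β' * t)).re := by
      simp only [Complex.mul_re, Complex.conj_re, Complex.conj_im]; ring
    rw [this]; ring
  rw [h1, h2]
  have hl2 : ‖a + l • c‖ ^ 2 < 1 := by nlinarith [norm_nonneg (a + l • c)]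
  by_cases hb : β' = 0
  · have ha' : α' ≠ 0 := by
      intro h
      rw [hαe, hβe, h, hb] at hαβ
      simp at hαβ
    have := norm_pos_iff.2 ha'
    have h3 : 0 < ‖α'‖ ^ 2 := by positivity
    rw [hb]; simp; nlinarith
  · have := norm_pos_iff.2 hb
    have h3 : 0 < ‖β'‖ ^ 2 := by positivity
    nlinarith [sq_nonneg ‖α'‖]

theorem c_ne {p : ℕ} {a y : EV p} (ha : ‖a‖ < 1) (hy : y ≠ 0) :
    y - (inner ℂ a y) • a ≠ 0 := by
  intro h
  rw [sub_eq_zero] at h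
  have h1 := congrArg (fun x => inner ℂ a x) h
  simp only [inner_smul_right] at h1
  rw [inner_self_eq_norm_sq_to_K] at h1
  have h2 : inner ℂ a y * (1 - ((‖a‖ : ℝ) : ℂ) ^ 2) = 0 := by
    linear_combination h1
  rcases mul_eq_zero.1 h2 with h3 | h3
  · rw [h3, zero_smul] at h; exact hy h
  · have : (1 : ℝ) - ‖a‖ ^ 2 = 0 := by exact_mod_cast h3
    nlinarith [norm_nonneg a]

noncomputable def Av (r : ℕ) (θ : ℝ) : Fin (r + 2) → ℂ := fun j =>
  if j = 0 then (Real.cos θ : ℂ) else if j = 1 then (Real.sin θ : ℂ) else 0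

noncomputable def Bv (r : ℕ) (θ : ℝ) : Fin (r + 2) → ℂ := fun j =>
  if j = 0 then -(Real.sin θ : ℂ) else if j = 1 then (Real.cos θ : ℂ) else 0

noncomputable def mat {p : ℕ} (r : ℕ) (θ : ℝ) (z w : EV p) : Matrix (Fin p) (Fin (r + 2)) ℂ :=
  fun i j => z i * Av r θ j + w i * Bv r θ j

theorem sum_two {r : ℕ} {g : Fin (r + 2) → ℂ} (h : ∀ j, j ≠ 0 → j ≠ 1 → g j = 0) :
    ∑ j, g j = g 0 + g 1 := by
  rw [Fin.sum_univ_succ, Fin.sum_univ_succ, Finset.sum_eq_zero, add_zero]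
  · rfl
  · intro i _
    apply h
    · exact Fin.succ_ne_zero _
    · intro h'
      have := congrArg Fin.val h'
      simp at this

theorem Av_dot {r : ℕ} (θ : ℝ) (x : Fin (r + 2) → ℂ) :
    ∑ j, Av r θ j * x j = Real.cos θ * x 0 + Real.sin θ * x 1 := by
  rw [sum_two]
  · simp [Av]
  · intro j h0 h1; simp [Av, h0, h1]

theorem Bv_dot {r : ℕ} (θ : ℝ) (x : Fin (r + 2) → ℂ) :
    ∑ j, Bv r θ j * x j = -(Real.sin θ) * x 0 + Real.cos θ * x 1 := by
  rw [sum_two]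
  · simp [Bv]
  · intro j h0 h1; simp [Bv, h0, h1]

theorem mat_mulVec {p r : ℕ} (θ : ℝ) (z w : EV p) (x : Fin (r + 2) → ℂ) :
    nsq (mat r θ z w *ᵥ x) = ‖(Real.cos θ * x 0 + Real.sin θ * x 1) • z +
      (-(Real.sin θ) * x 0 + Real.cos θ * x 1) • w‖ ^ 2 := by
  rw [EuclideanSpace.norm_sq_eq]
  unfold nsq
  refine Finset.sum_congr rfl fun i _ => ?_
  congr 2
  rw [← Av_dot, ← Bv_dot]
  simp only [mulVec, dotProduct, mat, PiLp.add_apply, PiLp.smul_apply, smul_eq_mul,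
    Finset.sum_mul, ← Finset.sum_add_distrib]
  refine Finset.sum_congr rfl fun j _ => ?_
  ring

theorem rot_norm (θ : ℝ) (x y : ℂ) : ‖Real.cos θ * x + Real.sin θ * y‖ ^ 2 +
    ‖-(Real.sin θ) * x + Real.cos θ * y‖ ^ 2 = ‖x‖ ^ 2 + ‖y‖ ^ 2 := by
  simp only [← Complex.normSq_eq_norm_sq, Complex.normSq_apply, Complex.add_re, Complex.add_im,
    Complex.mul_re, Complex.mul_im, Complex.neg_re, Complex.neg_im, Complex.ofReal_re,
    Complex.ofReal_im]
  have := Real.sin_sq_add_cos_sq θ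
  linear_combination (x.re ^ 2 + x.im ^ 2 + y.re ^ 2 + y.im ^ 2) * this

theorem two_le {r : ℕ} (x : Fin (r + 2) → ℂ) : ‖x 0‖ ^ 2 + ‖x 1‖ ^ 2 ≤ nsq x := by
  unfold nsq
  have : ({0, 1} : Finset (Fin (r + 2))).sum (fun i => ‖x i‖ ^ 2) ≤ ∑ i, ‖x i‖ ^ 2 :=
    Finset.sum_le_sum_of_subset_of_nonneg (Finset.subset_univ _) fun _ _ _ => by positivity
  rwa [Finset.sum_pair (by simp)] at this

theorem mat_mem {p r : ℕ} (θ : ℝ) {z w : EV p} (h : Dom2 z w) :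
    mat r θ z w ∈ typeIDomain p (r + 2) := by
  refine mem_dom.2 fun x hx => ?_
  rw [mat_mulVec]
  set α : ℂ := Real.cos θ * x 0 + Real.sin θ * x 1 with hα
  set β : ℂ := -(Real.sin θ) * x 0 + Real.cos θ * x 1 with hβ
  have h1 : ‖α‖ ^ 2 + ‖β‖ ^ 2 ≤ nsq x := by rw [hα, hβ, rot_norm]; exact two_le x
  by_cases hc : α ≠ 0 ∨ β ≠ 0
  · exact (h α β hc).trans_le h1
  · push Not at hc
    rw [hc.1, hc.2]
    simpa using nsq_pos hx

theorem mat_Av {p r : ℕ} (θ : ℝ) (z w : EV p) : nsq (mat r θ z w *ᵥ Av r θ) = ‖z‖ ^ 2 := by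
  rw [mat_mulVec]
  have h1 : (Real.cos θ : ℂ) * Av r θ 0 + Real.sin θ * Av r θ 1 = 1 := by
    simp only [Av, if_true, one_ne_zero, if_false]
    have := Real.sin_sq_add_cos_sq θ
    have h2 : ((Real.sin θ ^ 2 + Real.cos θ ^ 2 : ℝ) : ℂ) = 1 := by rw [this]; simp
    push_cast at h2 ⊢
    linear_combination h2
  have h2 : -(Real.sin θ : ℂ) * Av r θ 0 + Real.cos θ * Av r θ 1 = 0 := by
    simp only [Av, if_true, one_ne_zero, if_false]; ring
  rw [h1, h2]; simp

theorem nsq_Av {r : ℕ} (θ : ℝ) : nsq (Av r θ) = 1 := by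
  have : ((nsq (Av r θ) : ℝ) : ℂ) = 1 := by
    rw [← nsq_dot]
    have h := sum_two (r := r) (g := fun j => star (Av r θ j) * Av r θ j) (by
      intro j h0 h1; simp [Av, h0, h1])
    have e : star (Av r θ) ⬝ᵥ Av r θ = ∑ j, star (Av r θ j) * Av r θ j := rfl
    rw [e, h]
    simp only [Av, if_true, one_ne_zero, if_false, RCLike.star_def, Complex.conj_ofReal]
    have := Real.sin_sq_add_cos_sq θ
    have h2 : ((Real.sin θ ^ 2 + Real.cos θ ^ 2 : ℝ) : ℂ) = 1 := by rw [this]; simp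
    push_cast at h2 ⊢
    linear_combination h2
  exact_mod_cast this

theorem mat_line {p r : ℕ} (θ : ℝ) (z w : EV p) (s : ℂ) :
    mat r θ z 0 + s • (mat r θ z w - mat r θ z 0) = mat r θ z (s • w) := by
  ext i j
  simp [mat]
  ring

theorem coord_diff {p : ℕ} (i : Fin p) : Differentiable ℂ (fun z : EV p => z i) :=
  (EuclideanSpace.proj (𝕜 := ℂ) i : EV p →L[ℂ] ℂ).differentiable

theorem mat_diff {p r : ℕ} (θ : ℝ) :
    Differentiable ℂ (fun x : EV p × EV p => mat r θ x.1 x.2) := by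
  refine diff_mat fun i j => ?_
  have h1 : Differentiable ℂ (fun x : EV p × EV p => x.1 i) :=
    (coord_diff i).comp differentiable_fst
  have h2 : Differentiable ℂ (fun x : EV p × EV p => x.2 i) :=
    (coord_diff i).comp differentiable_snd
  exact (h1.mul_const _).add (h2.mul_const _)

theorem mat_rot {p r : ℕ} (s t : ℝ) (y w : EV p) :
    mat r t y w = mat r s ((Real.cos (t - s) : ℂ) • y - (Real.sin (t - s) : ℂ) • w)
      ((Real.sin (t - s) : ℂ) • y + (Real.cos (t - s) : ℂ) • w) := by
  have hA : ∀ j, Av r t j = Real.cos (t - s) * Av r s j + Real.sin (t - s) * Bv r s j := by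
    intro j
    have e : t = (t - s) + s := by ring
    unfold Av Bv
    by_cases h0 : j = 0
    · simp only [h0, if_true]
      conv_lhs => rw [e, Real.cos_add]
      push_cast; ring
    · by_cases h1 : j = 1
      · simp only [h1, one_ne_zero, if_true, if_false]
        conv_lhs => rw [e, Real.sin_add]
        push_cast; ring
      · simp [h0, h1]
  have hB : ∀ j, Bv r t j = -Real.sin (t - s) * Av r s j + Real.cos (t - s) * Bv r s j := by
    intro j
    have e : t = (t - s) + s := by ring
    unfold Av Bv
    by_cases h0 : j = 0
    · simp only [h0, if_true]
      conv_lhs => rw [e, Real.sin_add]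
      push_cast; ring
    · by_cases h1 : j = 1
      · simp only [h1, one_ne_zero, if_true, if_false]
        conv_lhs => rw [e, Real.cos_add]
        push_cast; ring
      · simp [h0, h1]
  ext i j
  simp only [mat, hA, hB, PiLp.add_apply, PiLp.sub_apply, PiLp.smul_apply, smul_eq_mul]
  ring

end

section

open Module Topology Filter

theorem line_convex {p : ℕ} (a c : EV p) (ρ : ℝ) : Convex ℝ {l : ℂ | ‖a + l • c‖ < ρ} := by
  intro x hx y hy α β hα hβ hab
  have h : a + (α • x + β • y) • c = (α : ℂ) • (a + x • c) + (β : ℂ) • (a + y • c) := by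
    have hab' : (α : ℂ) + β = 1 := by exact_mod_cast hab
    have e : (α • x + β • y : ℂ) = α * x + β * y := by simp
    rw [e]
    calc a + ((α : ℂ) * x + β * y) • c = ((α : ℂ) + β) • a + ((α : ℂ) * x + β * y) • c := by
          rw [hab', one_smul]
      _ = _ := by module
  show ‖a + (α • x + β • y) • c‖ < ρ
  rw [h]
  refine (norm_add_le _ _).trans_lt ?_
  rw [norm_smul, norm_smul, Complex.norm_real, Complex.norm_real, Real.norm_of_nonneg hα,
    Real.norm_of_nonneg hβ]
  have hx' : ‖a + x • c‖ < ρ := hx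
  have hy' : ‖a + y • c‖ < ρ := hy
  rcases hα.eq_or_lt with h0 | h0
  · have : β = 1 := by linarith
    rw [← h0, this]; linarith
  · have h1 := mul_lt_mul_of_pos_left hx' h0
    have h2 := mul_le_mul_of_nonneg_left hy'.le hβ
    have h3 : α * ρ + β * ρ = ρ := by rw [← add_mul, hab, one_mul]
    linarith

theorem line_open {p : ℕ} (a c : EV p) (ρ : ℝ) : IsOpen {l : ℂ | ‖a + l • c‖ < ρ} :=
  isOpen_lt (by fun_prop) continuous_const

/-- common vectors -/
noncomputable def EE {p a b : ℕ} (H : EV p → EV p → Matrix (Fin a) (Fin b) ℂ) (z : EV p) :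
    Submodule ℂ (Fin b → ℂ) :=
  ⨅ w : {w : EV p // ‖w‖ < 1 / 4}, LinearMap.ker (mulVecLin (H z w.1 - H z 0))

theorem mem_EE {p a b : ℕ} {H : EV p → EV p → Matrix (Fin a) (Fin b) ℂ} {z : EV p}
    {k : Fin b → ℂ} : k ∈ EE H z ↔ ∀ w, ‖w‖ < 1 / 4 → H z w *ᵥ k = H z 0 *ᵥ k := by
  unfold EE
  rw [Submodule.mem_iInf]
  constructor
  · intro h w hw
    have := h ⟨w, hw⟩
    simpa [sub_mulVec, sub_eq_zero] using this
  · rintro h ⟨w, hw⟩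
    simpa [sub_mulVec, sub_eq_zero] using h w hw

noncomputable def VV {p a b : ℕ} (H : EV p → EV p → Matrix (Fin a) (Fin b) ℂ) (ε : ℝ) :
    Submodule ℂ ((Fin a → ℂ) × (Fin b → ℂ)) :=
  Submodule.span ℂ {ξ | ∃ z k, ‖z‖ < ε ∧ k ∈ EE H z ∧ ξ = (H z 0 *ᵥ k, k)}

def OO (n p : ℕ) (ε : ℝ) : Set (EV p × (Fin (n + 1) → EV p)) :=
  {x | ‖x.1‖ < ε ∧ (∀ i, ‖x.2 i‖ < 1 / 4) ∧ x.2 0 = 0}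

def Th {n p a b : ℕ} (H : EV p → EV p → Matrix (Fin a) (Fin b) ℂ)
    (x : EV p × (Fin (n + 1) → EV p)) : Tup n a b := fun i => H x.1 (x.2 i)

theorem B0a {n p a b : ℕ} (H : EV p → EV p → Matrix (Fin a) (Fin b) ℂ) {ε : ℝ} (hε : 0 < ε)
    (hn : b ≤ n) : ∃ x ∈ OO n p ε, ∃ M : Tup n a b → ℂ, Differentiable ℂ M ∧ M (Th H x) ≠ 0 ∧
      ∀ x' ∈ OO n p ε, M (Th H x') ≠ 0 → ∀ z, ‖z‖ < ε →
        finrank ℂ (kerT (Th H x')) ≤ finrank ℂ (EE H z) := by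
  obtain ⟨z0, hz0, hmin⟩ : ∃ z0 : EV p, ‖z0‖ < ε ∧ ∀ z : EV p, ‖z‖ < ε →
      finrank ℂ (EE H z0) ≤ finrank ℂ (EE H z) := by
    have hne : ({z : EV p | ‖z‖ < ε}).Nonempty := ⟨0, by simpa using hε⟩
    obtain ⟨z0, h1, h2⟩ := exists_minimalFor_of_wellFoundedLT (fun z : EV p => ‖z‖ < ε)
      (fun z => finrank ℂ (EE H z)) hne
    refine ⟨z0, h1, fun z hz => ?_⟩
    rcases le_total (finrank ℂ (EE H z0)) (finrank ℂ (EE H z)) with h | h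
    · exact h
    · exact h2 hz h
  haveI : Inhabited {w : EV p // ‖w‖ < 1 / 4} := ⟨⟨0, by simp⟩⟩
  obtain ⟨w, hw⟩ := fin_tuple (fun w : {w : EV p // ‖w‖ < 1 / 4} =>
    LinearMap.ker (mulVecLin (H z0 w.1 - H z0 0))) n ⊤ (by simpa using hn)
  set pts : Fin (n + 1) → EV p := Fin.cons 0 (fun i => (w i).1) with hpts
  obtain ⟨M, hM, hM0, hM1⟩ := semicont (Th H (z0, pts))
  refine ⟨(z0, pts), ⟨hz0, ?_, by simp [hpts]⟩, M, hM, hM0, fun x' _ hx' z hz => ?_⟩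
  · intro i
    refine Fin.cases ?_ (fun i => ?_) i
    · simp [hpts]
    · simpa [hpts] using (w i).2
  · refine (hM1 _ hx').trans ((Submodule.finrank_mono ?_).trans (hmin z hz))
    intro k hk
    rw [mem_kerT] at hk
    unfold EE
    refine (Submodule.mem_iInf _).2 (hw k trivial fun i => ?_)
    have := hk i.succ
    simpa [Th, hpts, sub_mulVec, sub_eq_zero] using this

theorem B0joint {n p a b : ℕ} (H : EV p → EV p → Matrix (Fin a) (Fin b) ℂ)
    (H2 : EV p → EV p → Matrix (Fin b) (Fin a) ℂ)
    (hH : DifferentiableOn ℂ (fun x : EV p × EV p => H x.1 x.2) {x | Dom2 x.1 x.2})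
    (hH2 : DifferentiableOn ℂ (fun x : EV p × EV p => H2 x.1 x.2) {x | Dom2 x.1 x.2})
    {ε : ℝ} (hε : 0 < ε) (hε' : ε ≤ 1 / 4) (hn : b ≤ n) (hn2 : a ≤ n) :
    ∃ x ∈ OO n p ε, ∀ z, ‖z‖ < ε → finrank ℂ (kerT (Th H x)) ≤ finrank ℂ (EE H z) ∧
      finrank ℂ (kerT (Th H2 x)) ≤ finrank ℂ (EE H2 z) := by
  obtain ⟨x1, hx1, M1, hM1, hM10, hM1'⟩ := B0a H hε hn
  obtain ⟨x2, hx2, M2, hM2, hM20, hM2'⟩ := B0a H2 hε hn2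
  set X : ℂ → EV p × (Fin (n + 1) → EV p) := fun τ =>
    (x1.1 + τ • (x2.1 - x1.1), fun i => x1.2 i + τ • (x2.2 i - x1.2 i)) with hX
  set Ω : Set ℂ := {τ | ‖x1.1 + τ • (x2.1 - x1.1)‖ < ε} ∩
    ⋂ i, {τ | ‖x1.2 i + τ • (x2.2 i - x1.2 i)‖ < 1 / 4} with hΩ
  have hopen : IsOpen Ω := (line_open _ _ _).inter
    (isOpen_iInter_of_finite fun i => line_open _ _ _)
  have hconv : Convex ℝ Ω := (line_convex _ _ _).inter (convex_iInter fun i => line_convex _ _ _)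
  have hmem : ∀ τ ∈ Ω, X τ ∈ OO n p ε := by
    intro τ hτ
    refine ⟨hτ.1, fun i => Set.mem_iInter.1 hτ.2 i, ?_⟩
    simp [hX, hx1.2.2, hx2.2.2]
  have hX0 : X 0 = x1 := by simp [hX]
  have hX1 : X 1 = x2 := by simp [hX]
  have h0 : (0 : ℂ) ∈ Ω := by
    refine ⟨by simpa using hx1.1, Set.mem_iInter.2 fun i => by simpa using hx1.2.1 i⟩
  have h1 : (1 : ℂ) ∈ Ω := by
    refine ⟨by simpa using hx2.1, Set.mem_iInter.2 fun i => by simpa using hx2.2.1 i⟩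
  have hdom : ∀ i, ∀ τ ∈ Ω, Dom2 (X τ).1 ((X τ).2 i) := fun i τ hτ =>
    dom2_small (by linarith [(hmem τ hτ).1]) (by linarith [(hmem τ hτ).2.1 i])
  have hXd : ∀ i, Differentiable ℂ (fun τ => ((X τ).1, (X τ).2 i)) := by
    intro i; simp only [hX]; fun_prop
  have hd1 : DifferentiableOn ℂ (fun τ => M1 (Th H (X τ))) Ω :=
    hM1.comp_differentiableOn (differentiableOn_pi.2 fun i =>
      hH.comp (hXd i).differentiableOn (hdom i))
  have hd2 : DifferentiableOn ℂ (fun τ => M2 (Th H2 (X τ))) Ω :=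
    hM2.comp_differentiableOn (differentiableOn_pi.2 fun i =>
      hH2.comp (hXd i).differentiableOn (hdom i))
  by_contra hcon
  have hz : ∀ τ ∈ Ω, M1 (Th H (X τ)) ≠ 0 → M2 (Th H2 (X τ)) = 0 := by
    intro τ hτ hm1
    by_contra hm2
    exact hcon ⟨X τ, hmem τ hτ, fun z hz => ⟨hM1' _ (hmem τ hτ) hm1 z hz,
      hM2' _ (hmem τ hτ) hm2 z hz⟩⟩
  have hev : (fun τ => M2 (Th H2 (X τ))) =ᶠ[𝓝 0] 0 := by
    have hc : ContinuousAt (fun τ => M1 (Th H (X τ))) 0 :=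
      (hd1.differentiableAt (hopen.mem_nhds h0)).continuousAt
    filter_upwards [hopen.mem_nhds h0, hc.eventually_ne (by simpa [hX0] using hM10)] with τ h1 h2
    exact hz τ h1 h2
  have := AnalyticOnNhd.eqOn_zero_of_preconnected_of_eventuallyEq_zero
    (hd2.analyticOnNhd hopen) hconv.isPreconnected h0 hev h1
  simp only [hX1, Pi.zero_apply] at this
  exact hM20 this

theorem B0b {n p a b : ℕ} (H : EV p → EV p → Matrix (Fin a) (Fin b) ℂ) {ε : ℝ}
    {x : EV p × (Fin (n + 1) → EV p)} (hx : x ∈ OO n p ε)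
    (hmin : ∀ z, ‖z‖ < ε → finrank ℂ (kerT (Th H x)) ≤ finrank ℂ (EE H z)) (c : EV p)
    {Ω : Set ℂ} (hΩ : IsOpen Ω) (hc : IsPreconnected Ω) (h0 : (0 : ℂ) ∈ Ω)
    (hF : DifferentiableOn ℂ (fun l => (fun i => H (x.1 + l • c) (wl x.1 c (x.2 i) l) :
      Tup n a b)) Ω) :
    ∃ M : Tup n a b → ℂ, Differentiable ℂ M ∧ M (Th H x) ≠ 0 ∧
      ∀ G ∈ closure ((fun l => (fun i => H (x.1 + l • c) (wl x.1 c (x.2 i) l) :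
      Tup n a b)) '' Ω), M G ≠ 0 → ∀ u v, (∀ i, G i *ᵥ v = u) → (u, v) ∈ VV H ε := by
  have e0 : (fun i => H (x.1 + (0 : ℂ) • c) (wl x.1 c (x.2 i) 0) : Tup n a b) = Th H x := by
    funext i; simp [Th, wl_at_zero]
  have key := lemmaK hΩ hc h0 hF (VV H ε) ?_
  · rwa [e0] at key
  · rw [e0]
    have c1 : ∀ᶠ l in 𝓝 (0 : ℂ), ‖x.1 + l • c‖ < ε :=
      (line_open x.1 c ε).mem_nhds (by simpa using hx.1)
    have c2 : ∀ᶠ l in 𝓝 (0 : ℂ), ∀ i, ‖wl x.1 c (x.2 i) l‖ < 1 / 4 := by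
      refine eventually_all.2 fun i => ?_
      have hcont : Continuous (fun l => ‖wl x.1 c (x.2 i) l‖) := by unfold wl; fun_prop
      exact (isOpen_lt hcont continuous_const).mem_nhds (by simpa [wl_at_zero] using hx.2.1 i)
    filter_upwards [c1, c2] with l h1 h2
    refine ⟨EE H (x.1 + l • c), hmin _ h1, fun k hk => ?_⟩
    have hk' := mem_EE.1 hk
    have hw0 : wl x.1 c (x.2 0) l = 0 := by rw [hx.2.2, wl_zero]
    refine ⟨fun i => ?_, ?_⟩
    · rw [hk' _ (h2 i), hk' _ (h2 0)]
    · rw [hw0]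
      exact Submodule.subset_span ⟨_, k, h1, hk, rfl⟩

end

section

open Module Topology Filter

/-- transpose of a tuple -/
def tT {n a b : ℕ} (G : Tup n a b) : Tup n b a := fun i => (G i)ᵀ

theorem tT_diff {n a b : ℕ} : Differentiable ℂ (tT (n := n) (a := a) (b := b)) := by
  refine differentiable_pi.2 fun i => diff_mat fun x y => ?_
  exact diff_entry i y x

theorem tr_diff {a b : ℕ} :
    Differentiable ℂ (fun G : Matrix (Fin a) (Fin b) ℂ => Gᵀ) :=
  diff_mat fun x y => diff_mat_entry y x

/-- conjugate-swapped intersection -/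
def RR {a b : ℕ} (V : Submodule ℂ ((Fin a → ℂ) × (Fin b → ℂ)))
    (W : Submodule ℂ ((Fin b → ℂ) × (Fin a → ℂ))) :
    Submodule ℂ ((Fin a → ℂ) × (Fin b → ℂ)) where
  carrier := {ξ | ξ ∈ V ∧ (star ξ.2, star ξ.1) ∈ W}
  add_mem' := by
    rintro x y ⟨hx1, hx2⟩ ⟨hy1, hy2⟩
    refine ⟨V.add_mem hx1 hy1, ?_⟩
    have := W.add_mem hx2 hy2
    simpa [star_add] using this
  zero_mem' := by
    refine ⟨V.zero_mem, ?_⟩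
    change (star (0 : Fin b → ℂ), star (0 : Fin a → ℂ)) ∈ W
    rw [star_zero, star_zero]
    exact W.zero_mem
  smul_mem' := by
    rintro c x ⟨hx1, hx2⟩
    refine ⟨V.smul_mem c hx1, ?_⟩
    have := W.smul_mem (star c) hx2
    simpa [star_smul] using this

theorem mem_RR {a b : ℕ} {V : Submodule ℂ ((Fin a → ℂ) × (Fin b → ℂ))}
    {W : Submodule ℂ ((Fin b → ℂ) × (Fin a → ℂ))} {x : Fin a → ℂ} {k : Fin b → ℂ} :
    (x, k) ∈ RR V W ↔ (x, k) ∈ V ∧ (star k, star x) ∈ W := Iff.rfl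

theorem exists_orth {n p : ℕ} (hnp : n < p) (pts : Fin (n + 1) → EV p) (h0 : pts 0 = 0) :
    ∃ y : EV p, y ≠ 0 ∧ ∀ i, inner ℂ y (pts i) = 0 := by
  set S := Submodule.span ℂ (Set.range fun i : Fin n => pts i.succ) with hS
  have h1 : finrank ℂ S ≤ n := by
    have := finrank_range_le_card (R := ℂ) (fun i : Fin n => pts i.succ)
    simpa [Set.finrank] using this
  have h2 : S ≠ ⊤ := by
    intro h
    rw [h] at h1
    simp at h1
    omega
  have h3 : Sᗮ ≠ ⊥ := fun h => h2 (Submodule.orthogonal_eq_bot_iff.1 h)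
  obtain ⟨y, hy, hy0⟩ := Submodule.exists_mem_ne_zero_of_ne_bot h3
  refine ⟨y, hy0, fun i => ?_⟩
  refine Fin.cases ?_ (fun i => ?_) i
  · simp [h0]
  · have hm : pts i.succ ∈ S := Submodule.subset_span (Set.mem_range_self i)
    exact Submodule.inner_left_of_mem_orthogonal hm hy

theorem B1 {p r a b : ℕ} {f : Matrix (Fin p) (Fin (r + 2)) ℂ → Matrix (Fin a) (Fin b) ℂ}
    (hf : DifferentiableOn ℂ f (typeIDomain p (r + 2)))
    (hfp : ProperOn f (typeIDomain p (r + 2)) (typeIDomain a b)) (hap : a < p) (hbp : b < p)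
    (θ : ℝ) {ε : ℝ} (hε : 0 < ε) (hε' : ε ≤ 1 / 4) :
    ∃ z k, ‖z‖ < ε ∧ k ≠ 0 ∧
      (f (mat r θ z 0) *ᵥ k, k) ∈ VV (fun z w : EV p => f (mat r θ z w)) ε ∧
      (star k, star (f (mat r θ z 0) *ᵥ k)) ∈ VV (fun z w : EV p => (f (mat r θ z w))ᵀ) ε := by
  obtain ⟨n, rfl⟩ : ∃ n, p = n + 1 := ⟨p - 1, by omega⟩
  set H : EV (n + 1) → EV (n + 1) → Matrix (Fin a) (Fin b) ℂ :=
    fun z w => f (mat r θ z w) with hH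
  set H2 : EV (n + 1) → EV (n + 1) → Matrix (Fin b) (Fin a) ℂ :=
    fun z w => (f (mat r θ z w))ᵀ with hH2
  have hHd : DifferentiableOn ℂ (fun x : EV (n + 1) × EV (n + 1) => H x.1 x.2)
      {x | Dom2 x.1 x.2} := hf.comp (mat_diff θ).differentiableOn fun x hx => mat_mem θ hx
  have hH2d : DifferentiableOn ℂ (fun x : EV (n + 1) × EV (n + 1) => H2 x.1 x.2)
      {x | Dom2 x.1 x.2} := tr_diff.comp_differentiableOn hHd
  obtain ⟨x, hx, hmin⟩ := B0joint (n := n) H H2 hHd hH2d hε hε' (by omega) (by omega)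
  obtain ⟨y, hy0, hy⟩ := exists_orth (Nat.lt_succ_self n) x.2 hx.2.2
  have hz1 : ‖x.1‖ < 1 := by linarith [hx.1]
  set c := y - (inner ℂ x.1 y) • x.1 with hc
  have hc0 : c ≠ 0 := c_ne hz1 hy0
  have hdisc : ∀ l : ℂ, ‖x.1 + l • c‖ < 1 → ∀ i (s : ℂ), ‖s‖ < 2 →
      Dom2 (x.1 + l • c) (s • wl x.1 c (x.2 i) l) := by
    intro l hl i s hs
    rw [← wl_smul]
    refine disc (dom2_small (by linarith [hx.1]) ?_) ?_ hz1 hl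
    · rw [norm_smul]
      nlinarith [hx.2.1 i, norm_nonneg (x.2 i), norm_nonneg s]
    · rw [inner_smul_right, hy i, mul_zero]
  have hdisc1 : ∀ l : ℂ, ‖x.1 + l • c‖ < 1 → ∀ i,
      Dom2 (x.1 + l • c) (wl x.1 c (x.2 i) l) := by
    intro l hl i
    simpa using hdisc l hl i 1 (by simp)
  set Z : ℂ → Tup n (n + 1) (r + 2) := fun l i => mat r θ (x.1 + l • c) (wl x.1 c (x.2 i) l)
    with hZ
  set F : ℂ → Tup n a b := fun l i => H (x.1 + l • c) (wl x.1 c (x.2 i) l) with hF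
  set F2 : ℂ → Tup n b a := fun l i => H2 (x.1 + l • c) (wl x.1 c (x.2 i) l) with hF2
  set Ω : Set ℂ := {l | ‖x.1 + l • c‖ < 1} with hΩ
  have hΩo : IsOpen Ω := line_open _ _ _
  have hΩc : IsPreconnected Ω := (line_convex x.1 c 1).isPreconnected
  have hΩ0 : (0 : ℂ) ∈ Ω := by simpa [hΩ] using hz1
  have hFd : DifferentiableOn ℂ F Ω := by
    refine differentiableOn_pi.2 fun i => ?_
    have hd : Differentiable ℂ (fun l : ℂ => (x.1 + l • c, wl x.1 c (x.2 i) l)) := by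
      unfold wl; fun_prop
    exact hHd.comp hd.differentiableOn fun l hl => hdisc1 l hl i
  have hF2d : DifferentiableOn ℂ F2 Ω := tT_diff.comp_differentiableOn hFd
  have hF0 : F 0 = Th H x := by
    funext i; simp [hF, Th, wl_at_zero]
  have hF20 : F2 0 = Th H2 x := by
    funext i; simp [hF2, Th, wl_at_zero]
  obtain ⟨M1, hM1, hM10, hM1'⟩ := B0b H hx (fun z hz => (hmin z hz).1) c hΩo hΩc hΩ0 hFd
  obtain ⟨M2, hM2, hM20, hM2'⟩ := B0b H2 hx (fun z hz => (hmin z hz).2) c hΩo hΩc hΩ0 hF2d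
  by_contra hcon
  obtain ⟨Q, hQ, hQ0, hQ'⟩ := lemmaQ (Th H x) (RR (VV H ε) (VV H2 ε)) (by
    intro k hk
    by_contra hk0
    have e : Th H x 0 = f (mat r θ x.1 0) := by simp [Th, hH, hx.2.2]
    rw [e, mem_RR] at hk
    exact hcon ⟨x.1, k, hx.1, hk0, hk.1, hk.2⟩)
  have hbdd : Bornology.IsBounded Ω := by
    rw [isBounded_iff_forall_norm_le]
    refine ⟨2 / ‖c‖, fun l hl => ?_⟩
    have hl' : ‖x.1 + l • c‖ < 1 := hl
    rw [le_div_iff₀ (norm_pos_iff.2 hc0), ← norm_smul]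
    have : l • c = (x.1 + l • c) - x.1 := by abel
    rw [this]
    linarith [norm_sub_le (x.1 + l • c) x.1]
  have hw0 : ∀ l, wl x.1 c (x.2 0) l = 0 := fun l => by rw [hx.2.2, wl_zero]
  obtain ⟨A, hA, u, v, hu, hv, hAv, hAu, hG⟩ := lemmaBd (h := fun l : ℂ => ‖x.1 + l • c‖)
    (l0 := 0) (F := F) (G := fun G => M1 G * M2 (tT G) * Q G) (by fun_prop) hbdd hΩ0 hFd
    (fun l hl i x => contr_le (hfp.1 (mat_mem θ (hdisc1 l hl i))) x)
    ((hM1.mul (hM2.comp tT_diff)).mul hQ)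
    (by
      have e : tT (F 0) = F2 0 := rfl
      simp only [e]
      rw [hF20, hF0]
      exact mul_ne_zero (mul_ne_zero hM10 hM20) hQ0)
    (approx_hyp hf hfp (R := 2) (by norm_num) (Z := Z) (h := fun l : ℂ => ‖x.1 + l • c‖) (by
      intro l hl i s hs
      simp only [hZ, hw0]
      rw [mat_line]
      exact mat_mem θ (hdisc l hl i s hs)) (by
      intro ρ hρ
      refine ⟨(1 + ρ) / 2, by linarith, fun l hl1 hl2 => ⟨Av r θ, nsq_Av θ, ?_⟩⟩
      simp only [hZ]
      rw [mat_Av]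
      by_cases h : 0 ≤ (1 + ρ) / 2
      · nlinarith [sq_nonneg (1 - ρ)]
      · nlinarith [sq_nonneg ‖x.1 + l • c‖]))
  have hG1 : M1 A ≠ 0 := fun h => hG (by simp [h])
  have hG2 : M2 (tT A) ≠ 0 := fun h => hG (by simp [h])
  have hG3 : Q A ≠ 0 := fun h => hG (by simp [h])
  have hA2 : tT A ∈ closure (F2 '' Ω) :=
    map_mem_closure tT_diff.continuous hA (by
      rintro _ ⟨l, hl, rfl⟩
      exact ⟨l, hl, rfl⟩)
  have r1 : (u, v) ∈ VV H ε := hM1' A hA hG1 u v hAv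
  have r2 : (star v, star u) ∈ VV H2 ε := by
    refine hM2' (tT A) hA2 hG2 (star v) (star u) fun i => ?_
    have := congrArg star (hAu i)
    rw [star_mulVec, conjTranspose_conjTranspose] at this
    rw [← this, ← mulVec_transpose]; rfl
  have hv0 := hQ' A u v hG3 (hAv 0) (mem_RR.2 ⟨r1, r2⟩)
  rw [hv0, nsq_zero] at hv
  exact zero_ne_one hv

theorem VV_orth {p r a b : ℕ} {f : Matrix (Fin p) (Fin (r + 2)) ℂ → Matrix (Fin a) (Fin b) ℂ}
    {s t σ : ℝ} (hσ : 0 < σ) (hσ1 : σ ≤ 1) (hst : σ ≤ |Real.sin (t - s)|)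
    {x : Fin a → ℂ} {k : Fin b → ℂ} {m : Fin b → ℂ} {l : Fin a → ℂ}
    (h1 : (x, k) ∈ VV (fun z w : EV p => f (mat r s z w)) (σ / 16))
    (h2 : (m, l) ∈ VV (fun z w : EV p => (f (mat r t z w))ᵀ) (σ / 16)) :
    l ⬝ᵥ x - m ⬝ᵥ k = 0 := by
  suffices hs : ∀ ξ ∈ VV (fun z w : EV p => f (mat r s z w)) (σ / 16),
      ∀ η ∈ VV (fun z w : EV p => (f (mat r t z w))ᵀ) (σ / 16),
      η.2 ⬝ᵥ ξ.1 - η.1 ⬝ᵥ ξ.2 = 0 from hs _ h1 _ h2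
  intro ξ hξ η hη
  induction hξ using Submodule.span_induction with
  | zero => simp
  | add ξ ξ' _ _ h h' =>
    simp only [Prod.fst_add, Prod.snd_add, dotProduct_add]
    linear_combination h + h'
  | smul c ξ _ h =>
    simp only [Prod.smul_fst, Prod.smul_snd, dotProduct_smul, smul_eq_mul]
    linear_combination c * h
  | mem ξ hξ =>
    obtain ⟨z, k, hz, hk, rfl⟩ := hξ
    induction hη using Submodule.span_induction with
    | zero => simp
    | add ξ ξ' _ _ h h' =>
      simp only [Prod.fst_add, Prod.snd_add, add_dotProduct]
      linear_combination h + h'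
    | smul c ξ _ h =>
      simp only [Prod.smul_fst, Prod.smul_snd, smul_dotProduct, smul_eq_mul]
      linear_combination c * h
    | mem η hη =>
      obtain ⟨y, l, hy, hl, rfl⟩ := hη
      have hsin : Real.sin (t - s) ≠ 0 := by
        intro h; rw [h, abs_zero] at hst; linarith
      have hsinc : (Real.sin (t - s) : ℂ) ≠ 0 := by exact_mod_cast hsin
      have hcosn : ‖(Real.cos (t - s) : ℂ)‖ ≤ 1 := by
        rw [Complex.norm_real]; exact Real.abs_cos_le_one _
      have hsinn : ‖(Real.sin (t - s) : ℂ)‖ ≤ 1 := by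
        rw [Complex.norm_real]; exact Real.abs_sin_le_one _
      have hsinl : σ ≤ ‖(Real.sin (t - s) : ℂ)‖ := by
        rw [Complex.norm_real]; exact hst
      set C : ℂ := (Real.cos (t - s) : ℂ) with hC
      set S : ℂ := (Real.sin (t - s) : ℂ) with hS
      set w' : EV p := S⁻¹ • (C • y - z) with hw'
      have e1 : S • w' = C • y - z := by rw [hw', smul_smul, mul_inv_cancel₀ hsinc, one_smul]
      have n1 : ‖w'‖ ≤ 1 / 8 := by
        have h1 : ‖S‖ * ‖w'‖ = ‖C • y - z‖ := by rw [← norm_smul, e1]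
        have h2 : ‖C • y - z‖ ≤ σ / 8 := by
          refine (norm_sub_le _ _).trans ?_
          rw [norm_smul]
          nlinarith [norm_nonneg y]
        have h3 : σ * ‖w'‖ ≤ σ * (1 / 8) := by
          nlinarith [mul_le_mul_of_nonneg_right hsinl (norm_nonneg w')]
        exact le_of_mul_le_mul_left h3 hσ
      have n2 : ‖S • y + C • w'‖ < 1 / 4 := by
        refine (norm_add_le _ _).trans_lt ?_
        rw [norm_smul, norm_smul]
        nlinarith [norm_nonneg y, norm_nonneg w']
      have e2 : mat r t y w' = mat r s z (S • y + C • w') := by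
        rw [mat_rot s t y w', ← hS, ← hC, e1, sub_sub_cancel]
      have k1 := mem_EE.1 hk _ n2
      have l1 := mem_EE.1 hl w' (by linarith)
      simp only [← k1, ← l1, e2]
      rw [dotProduct_mulVec, mulVec_transpose, sub_self]

theorem partB {p r a b : ℕ} {f : Matrix (Fin p) (Fin (r + 2)) ℂ → Matrix (Fin a) (Fin b) ℂ}
    (hf : DifferentiableOn ℂ f (typeIDomain p (r + 2)))
    (hfp : ProperOn f (typeIDomain p (r + 2)) (typeIDomain a b)) (hbp : b < p) : p ≤ a := by
  by_contra hap
  push Not at hap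
  set N := a + b + 1 with hN
  set θ : Fin N → ℝ := fun s => (s : ℝ) / N with hθ
  have hNpos : (0 : ℝ) < N := by rw [hN]; positivity
  have hsin : ∀ s t, s ≠ t → Real.sin (θ t - θ s) ≠ 0 := by
    intro s t hst h
    have b1 : ∀ s : Fin N, 0 ≤ θ s ∧ θ s < 1 := fun s => by
      refine ⟨by simp only [hθ]; positivity, ?_⟩
      simp only [hθ]
      rw [div_lt_one hNpos]
      exact_mod_cast s.2
    have := Real.pi_gt_three
    have h0 := (Real.sin_eq_zero_iff_of_lt_of_lt (by linarith [(b1 s).2, (b1 t).1])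
      (by linarith [(b1 t).2, (b1 s).1])).1 h
    simp only [hθ] at h0
    rw [← sub_div, div_eq_zero_iff] at h0
    rcases h0 with h0 | h0
    · apply hst
      have : (t : ℝ) = s := by linarith
      exact Fin.ext (by exact_mod_cast this.symm)
    · exact hNpos.ne' h0
  obtain ⟨σ, hσ, hσ1, hσ2⟩ : ∃ σ : ℝ, 0 < σ ∧ σ ≤ 1 ∧
      ∀ s t, s ≠ t → σ ≤ |Real.sin (θ t - θ s)| := by
    haveI : Nonempty (Fin N × Fin N) := ⟨(⟨0, by omega⟩, ⟨0, by omega⟩)⟩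
    obtain ⟨st0, h0⟩ := Finite.exists_min (fun st : Fin N × Fin N =>
      if st.1 = st.2 then (1 : ℝ) else |Real.sin (θ st.2 - θ st.1)|)
    refine ⟨if st0.1 = st0.2 then (1 : ℝ) else |Real.sin (θ st0.2 - θ st0.1)|,
      ?_, ?_, fun s t hst => ?_⟩
    · split_ifs with h
      · norm_num
      · exact abs_pos.2 (hsin _ _ h)
    · have := h0 (⟨0, by omega⟩, ⟨0, by omega⟩)
      simpa using this
    · have := h0 (s, t)
      simpa [hst] using this
  have hB := fun s => B1 hf hfp hap hbp (θ s) (ε := σ / 16) (by linarith) (by linarith)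
  choose z k hz hk0 h1 h2 using hB
  set ξ : Fin N → (Fin a → ℂ) × (Fin b → ℂ) := fun s => (f (mat r (θ s) (z s) 0) *ᵥ k s, k s)
    with hξ
  have horth : ∀ s t, s ≠ t → star (ξ t).1 ⬝ᵥ (ξ s).1 - star (ξ t).2 ⬝ᵥ (ξ s).2 = 0 :=
    fun s t hst => VV_orth hσ hσ1 (hσ2 s t hst) (h1 s) (h2 t)
  have hneg : ∀ s, nsq (ξ s).1 < nsq (ξ s).2 := fun s =>
    mem_dom.1 (hfp.1 (mat_mem (θ s) (dom2_small (by linarith [hz s]) (by simp)))) (k s) (hk0 s)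
  have hli : LinearIndependent ℂ ξ := by
    rw [Fintype.linearIndependent_iff]
    intro g hg t
    have g1 : ∑ s, g s • (ξ s).1 = 0 := by
      have := congrArg Prod.fst hg
      simpa [Prod.fst_sum] using this
    have g2 : ∑ s, g s • (ξ s).2 = 0 := by
      have := congrArg Prod.snd hg
      simpa [Prod.snd_sum] using this
    have e : ∑ s, g s * (star (ξ t).1 ⬝ᵥ (ξ s).1 - star (ξ t).2 ⬝ᵥ (ξ s).2) = 0 := by
      have q1 := congrArg (fun v => star (ξ t).1 ⬝ᵥ v) g1
      have q2 := congrArg (fun v => star (ξ t).2 ⬝ᵥ v) g2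
      simp only [dotProduct_sum, dotProduct_smul, dotProduct_zero, smul_eq_mul] at q1 q2
      simp only [mul_sub, Finset.sum_sub_distrib, q1, q2, sub_self]
    rw [Finset.sum_eq_single t] at e
    · rw [nsq_dot, nsq_dot] at e
      rcases mul_eq_zero.1 e with h | h
      · exact h
      · have : nsq (ξ t).1 - nsq (ξ t).2 = 0 := by exact_mod_cast h
        linarith [hneg t]
    · intro s _ hst
      rw [horth s t hst, mul_zero]
    · simp
  have := hli.fintype_card_le_finrank
  simp at this
  omega

end

/-- For a proper holomorphic map `f : D^I_{p,q} → D^I_{p',q'}` with `p ≥ q ≥ 2`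
and `q' < p`, one has `q ≤ q'` and `p ≤ p'`. -/
theorem stmt_2 (p q p' q' : ℕ) (h0p : 0 < p) (h0q : 0 < q) (h0p' : 0 < p') (h0q' : 0 < q')
    (hqp : q ≤ p) (h2q : 2 ≤ q) (hq'p : q' < p)
    (f : Matrix (Fin p) (Fin q) ℂ → Matrix (Fin p') (Fin q') ℂ)
    (hf : DifferentiableOn ℂ f (typeIDomain p q))
    (hfp : ProperOn f (typeIDomain p q) (typeIDomain p' q')) :
    q ≤ q' ∧ p ≤ p' := by
  obtain ⟨r, rfl⟩ : ∃ r, q = r + 2 := ⟨q - 2, by omega⟩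
  exact ⟨partA hqp hf hfp, partB hf hfp hq'p⟩
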